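/- (Theorem 5.1) Let u₀, v₀ be real-analytic functions on a neighborhood of the origin in ℝ² with ∂₁u₀ + ∂₂v₀ = 0 and u₀(0,0)·v₀(0,0) ≠ 0. Then there exist T > 0, a neighborhood W of the origin, and real-analytic functions u, v, p, g₁₁, g₁₂, g₂₂ on W × (−T, T) such that: (i) (u, v, p) satisfies the incompressible Euler equations ∂₁(u²+p)+∂₂(uv) = −∂_t u, ∂₁(uv)+∂₂(v²+p) = −∂_t v, ∂₁u+∂₂v = 0, with (u, v)(·, 0) = (u₀, v₀); (ii) det g := g₁₁g₂₂ − g₁₂² > 0; and (iii) for every t ∈ (−T, T), the triple L := v² + p, M := −uv, N := u² + p together with the metric g(·, t) satisfies the Gauss–Codazzi equations, so in particular the Gauss curvature of g(·,t) equals κ = p² + p(u² + v²). -/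

import Mathlib

noncomputable def sd1 (f : ℝ × ℝ → ℝ) (x : ℝ × ℝ) : ℝ :=
  deriv (fun s => f (s, x.2)) x.1

noncomputable def sd2 (f : ℝ × ℝ → ℝ) (x : ℝ × ℝ) : ℝ :=
  deriv (fun s => f (x.1, s)) x.2

noncomputable def pdx1 (f : ℝ × ℝ × ℝ → ℝ) (q : ℝ × ℝ × ℝ) : ℝ :=
  deriv (fun s => f (s, q.2.1, q.2.2)) q.1

noncomputable def pdx2 (f : ℝ × ℝ × ℝ → ℝ) (q : ℝ × ℝ × ℝ) : ℝ :=
  deriv (fun s => f (q.1, s, q.2.2)) q.2.1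

noncomputable def pdt (f : ℝ × ℝ × ℝ → ℝ) (q : ℝ × ℝ × ℝ) : ℝ :=
  deriv (fun s => f (q.1, q.2.1, s)) q.2.2

/-- Determinant of the metric `g₁₁g₂₂ - g₁₂²`. -/
noncomputable def detg (g11 g12 g22 : ℝ × ℝ × ℝ → ℝ) (q : ℝ × ℝ × ℝ) : ℝ :=
  g11 q * g22 q - (g12 q) ^ 2

/-- Christoffel symbol Γ¹₁₁. -/
noncomputable def Gamma1_11 (g11 g12 g22 : ℝ × ℝ × ℝ → ℝ) (q : ℝ × ℝ × ℝ) : ℝ :=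
  (g22 q * pdx1 g11 q - g12 q * (2 * pdx1 g12 q - pdx2 g11 q)) / (2 * detg g11 g12 g22 q)

/-- Christoffel symbol Γ¹₁₂. -/
noncomputable def Gamma1_12 (g11 g12 g22 : ℝ × ℝ × ℝ → ℝ) (q : ℝ × ℝ × ℝ) : ℝ :=
  (g22 q * pdx2 g11 q - g12 q * pdx1 g22 q) / (2 * detg g11 g12 g22 q)

/-- Christoffel symbol Γ¹₂₂. -/
noncomputable def Gamma1_22 (g11 g12 g22 : ℝ × ℝ × ℝ → ℝ) (q : ℝ × ℝ × ℝ) : ℝ :=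
  (g22 q * (2 * pdx2 g12 q - pdx1 g22 q) - g12 q * pdx2 g22 q) / (2 * detg g11 g12 g22 q)

/-- Christoffel symbol Γ²₁₁. -/
noncomputable def Gamma2_11 (g11 g12 g22 : ℝ × ℝ × ℝ → ℝ) (q : ℝ × ℝ × ℝ) : ℝ :=
  (-(g12 q) * pdx1 g11 q + g11 q * (2 * pdx1 g12 q - pdx2 g11 q)) / (2 * detg g11 g12 g22 q)

/-- Christoffel symbol Γ²₁₂. -/
noncomputable def Gamma2_12 (g11 g12 g22 : ℝ × ℝ × ℝ → ℝ) (q : ℝ × ℝ × ℝ) : ℝ :=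
  (-(g12 q) * pdx2 g11 q + g11 q * pdx1 g22 q) / (2 * detg g11 g12 g22 q)

/-- Christoffel symbol Γ²₂₂. -/
noncomputable def Gamma2_22 (g11 g12 g22 : ℝ × ℝ × ℝ → ℝ) (q : ℝ × ℝ × ℝ) : ℝ :=
  (-(g12 q) * (2 * pdx2 g12 q - pdx1 g22 q) + g11 q * pdx2 g22 q) / (2 * detg g11 g12 g22 q)

/-- Gauss curvature of `g` via the Brioschi formula (spatial derivatives). -/
noncomputable def brioschi (g11 g12 g22 : ℝ × ℝ × ℝ → ℝ) (q : ℝ × ℝ × ℝ) : ℝ :=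
  (1 / (2 * (detg g11 g12 g22 q) ^ 2)) *
    Matrix.det !![-(pdx2 (pdx2 g11) q) + 2 * pdx1 (pdx2 g12) q - pdx1 (pdx1 g22) q,
                    pdx1 g11 q, 2 * pdx1 g12 q - pdx2 g11 q;
                  2 * pdx2 g12 q - pdx1 g22 q, 2 * g11 q, 2 * g12 q;
                  pdx2 g22 q, 2 * g12 q, 2 * g22 q]
  - (1 / (2 * (detg g11 g12 g22 q) ^ 2)) *
    Matrix.det !![0, pdx2 g11 q, pdx1 g22 q;
                  pdx2 g11 q, 2 * g11 q, 2 * g12 q;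
                  pdx1 g22 q, 2 * g12 q, 2 * g22 q]

/-- The Gauss–Codazzi equations for `(L, M, N)` and the metric `g` at the point `q`. -/
def GaussCodazzi (L M N g11 g12 g22 : ℝ × ℝ × ℝ → ℝ) (q : ℝ × ℝ × ℝ) : Prop :=
  pdx1 N q - pdx2 M q =
    -(Gamma1_22 g11 g12 g22 q) * L q + 2 * Gamma1_12 g11 g12 g22 q * M q
      - Gamma1_11 g11 g12 g22 q * N q ∧
  pdx1 M q - pdx2 L q =
    Gamma2_22 g11 g12 g22 q * L q - 2 * Gamma2_12 g11 g12 g22 q * M q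
      + Gamma2_11 g11 g12 g22 q * N q ∧
  L q * N q - (M q) ^ 2 = brioschi g11 g12 g22 q


set_option linter.unusedSimpArgs false

namespace CK

open MvPowerSeries Finsupp

/-- formal power series in the variables `x₁, x₂, t` (indices `0, 1, 2`). -/
abbrev PS := MvPowerSeries (Fin 3) ℝ

/-- formal partial derivative. -/
noncomputable def dd (i : Fin 3) (f : PS) : PS := pderiv ℝ i f

/-- formal antiderivative vanishing where the variable `i` vanishes. -/
noncomputable def JJ (i : Fin 3) (f : PS) : PS :=
  fun m => if m i = 0 then 0 else coeff (m - single i 1) f / (m i : ℝ)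

lemma coeff_dd (i : Fin 3) (f : PS) (m : Fin 3 →₀ ℕ) :
    coeff m (dd i f) = coeff (m + single i 1) f * (m i + 1) := by
  rw [dd, coeff_pderiv]

lemma coeff_JJ (i : Fin 3) (f : PS) (m : Fin 3 →₀ ℕ) :
    coeff m (JJ i f) = if m i = 0 then 0 else coeff (m - single i 1) f / (m i : ℝ) := rfl

lemma coeff_JJ_zero (i : Fin 3) (f : PS) (m : Fin 3 →₀ ℕ) (h : m i = 0) :
    coeff m (JJ i f) = 0 := by simp [coeff_JJ, h]

lemma coeff_JJ_succ (i : Fin 3) (f : PS) (m : Fin 3 →₀ ℕ) :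
    coeff (m + single i 1) (JJ i f) = coeff m f / ((m i : ℝ) + 1) := by
  simp [coeff_JJ]

lemma exists_pred (i : Fin 3) (m : Fin 3 →₀ ℕ) (h : m i ≠ 0) :
    ∃ m', m = m' + single i 1 := by
  refine ⟨m - single i 1, ?_⟩
  ext j
  by_cases hj : j = i
  · subst hj; simp; omega
  · simp [Finsupp.single_apply, Ne.symm hj]

lemma dd_add (i : Fin 3) (f g : PS) : dd i (f + g) = dd i f + dd i g := by simp [dd]
lemma dd_sub (i : Fin 3) (f g : PS) : dd i (f - g) = dd i f - dd i g := by simp [dd]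
lemma dd_neg (i : Fin 3) (f : PS) : dd i (-f) = -dd i f := by simp [dd]
lemma dd_zero (i : Fin 3) : dd i (0 : PS) = 0 := by simp [dd]
lemma dd_one (i : Fin 3) : dd i (1 : PS) = 0 := by simp [dd]
lemma dd_mul (i : Fin 3) (f g : PS) : dd i (f * g) = dd i f * g + f * dd i g := by
  simp [dd, Derivation.leibniz]; ring

lemma dd_comm (i j : Fin 3) (f : PS) : dd i (dd j f) = dd j (dd i f) := by
  ext m
  simp only [coeff_dd]
  rw [add_right_comm]
  by_cases h : i = j
  · subst h; rfl
  · simp [Finsupp.single_apply, h, Ne.symm h]; ring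

lemma dd_JJ (i : Fin 3) (f : PS) : dd i (JJ i f) = f := by
  ext m
  rw [coeff_dd, coeff_JJ_succ]
  have : (m i : ℝ) + 1 ≠ 0 := by positivity
  field_simp

lemma dd_JJ_ne (i j : Fin 3) (h : i ≠ j) (f : PS) : dd i (JJ j f) = JJ j (dd i f) := by
  ext m
  by_cases hm : m j = 0
  · rw [coeff_dd, coeff_JJ_zero _ _ _ hm, coeff_JJ_zero, zero_mul]
    simp [Finsupp.single_apply, h, hm]
  · obtain ⟨m, rfl⟩ := exists_pred j m hm
    rw [coeff_dd, coeff_JJ_succ, add_right_comm, coeff_JJ_succ, coeff_dd]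
    simp [Finsupp.single_apply, h, Ne.symm h]; ring

lemma JJ_add (i : Fin 3) (f g : PS) : JJ i (f + g) = JJ i f + JJ i g := by
  ext m
  simp only [coeff_JJ, map_add]
  split_ifs
  · simp
  · ring

lemma JJ_neg (i : Fin 3) (f : PS) : JJ i (-f) = -JJ i f := by
  ext m
  simp only [coeff_JJ, map_neg]
  split_ifs
  · simp
  · ring

lemma JJ_sub (i : Fin 3) (f g : PS) : JJ i (f - g) = JJ i f - JJ i g := by
  rw [sub_eq_add_neg, JJ_add, JJ_neg, ← sub_eq_add_neg]

lemma JJ_z (i : Fin 3) : JJ i (0 : PS) = 0 := by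
  ext m; simp [coeff_JJ]

-- weights

noncomputable def ell (a : Fin 3 → ℝ) : MvPolynomial (Fin 3) ℝ :=
  ∑ i, MvPolynomial.C (a i) * MvPolynomial.X i

noncomputable def cc (a : Fin 3 → ℝ) (m : Fin 3 →₀ ℕ) : ℝ :=
  MvPolynomial.coeff m (ell a ^ m.degree)

noncomputable def bb (n : ℕ) : ℝ := 1 / (8 * ((n : ℝ) + 1) ^ 2)

noncomputable def wt (a : Fin 3 → ℝ) (m : Fin 3 →₀ ℕ) : ℝ := bb m.degree * cc a m

lemma bb_pos (n : ℕ) : 0 < bb n := by unfold bb; positivity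

lemma ell_hom (a : Fin 3 → ℝ) : (ell a).IsHomogeneous 1 := by
  unfold ell
  apply MvPolynomial.IsHomogeneous.sum
  intro i _
  simpa using (MvPolynomial.isHomogeneous_C (Fin 3) (a i)).mul (MvPolynomial.isHomogeneous_X ℝ i)

lemma coeff_ell_pow_ne (a : Fin 3 → ℝ) (n : ℕ) (m : Fin 3 →₀ ℕ) (h : m.degree ≠ n) :
    MvPolynomial.coeff m (ell a ^ n) = 0 := by
  have := (ell_hom a).pow n
  rw [one_mul] at this
  exact this.coeff_eq_zero h

lemma cc_succ (a : Fin 3 → ℝ) (m : Fin 3 →₀ ℕ) (i : Fin 3) :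
    cc a (m + single i 1) * (m i + 1) = (m.degree + 1) * a i * cc a m := by
  have h1 : MvPolynomial.pderiv i (ell a) = MvPolynomial.C (a i) := by
    unfold ell
    fin_cases i <;> simp [Fin.sum_univ_three, MvPolynomial.pderiv_X, Pi.single_apply]
  have h2 : MvPolynomial.pderiv i (ell a ^ (m.degree + 1)) =
      MvPolynomial.C (((m.degree : ℝ) + 1) * a i) * ell a ^ m.degree := by
    rw [Derivation.leibniz_pow, h1]
    simp
    ring
  have h3 := MvPolynomial.coeff_pderiv (i := i) (ell a ^ (m.degree + 1)) m
  rw [h2, MvPolynomial.coeff_C_mul] at h3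
  unfold cc
  have : (m + single i 1).degree = m.degree + 1 := by simp [map_add]
  rw [this, ← h3]

lemma cc_zero (a : Fin 3 → ℝ) : cc a 0 = 1 := by simp [cc]

lemma ind_succ {p : (Fin 3 →₀ ℕ) → Prop} (h0 : p 0)
    (hs : ∀ m i, p m → p (m + single i 1)) (m : Fin 3 →₀ ℕ) : p m := by
  induction hn : m.degree generalizing m with
  | zero => rw [Finsupp.degree_eq_zero_iff] at hn; subst hn; exact h0
  | succ n ih =>
    have : ∃ i, m i ≠ 0 := by
      by_contra! hc
      have : m = 0 := by ext i; simp [hc]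
      simp [this] at hn
    obtain ⟨i, hi⟩ := this
    obtain ⟨m', rfl⟩ := exists_pred i m hi
    refine hs _ _ (ih _ ?_)
    simpa [map_add] using hn

lemma cc_pos (a : Fin 3 → ℝ) (ha : ∀ i, 0 < a i) (m : Fin 3 →₀ ℕ) : 0 < cc a m := by
  induction m using ind_succ with
  | h0 => simp [cc_zero]
  | hs m i h =>
    have := cc_succ a m i
    have h2 : 0 < (m.degree + 1) * a i * cc a m := by have := ha i; positivity
    rw [← this] at h2
    exact pos_of_mul_pos_left h2 (by positivity)

lemma le_degree' (m : Fin 3 →₀ ℕ) (i : Fin 3) : m i ≤ m.degree := Finsupp.le_degree i m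

lemma cc_lower (a : Fin 3 → ℝ) (β : ℝ) (hβ : 0 < β) (ha : ∀ i, β ≤ a i) (m : Fin 3 →₀ ℕ) :
    β ^ m.degree ≤ cc a m := by
  have hp := cc_pos a (fun i => hβ.trans_le (ha i))
  induction m using ind_succ with
  | h0 => simp [cc_zero]
  | hs m i h =>
    have h1 := cc_succ a m i
    have h2 : (m + single i 1).degree = m.degree + 1 := by simp [map_add]
    rw [h2, pow_succ]
    have h3 : (m i : ℝ) ≤ m.degree := by exact_mod_cast le_degree' m i
    have h4 : β ^ m.degree * β ≤ cc a m * a i :=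
      mul_le_mul h (ha i) hβ.le (hp m).le
    have h5 : (m i + 1) * (cc a m * a i) ≤ cc a (m + single i 1) * (m i + 1) := by
      rw [h1]
      have : 0 < cc a m * a i := mul_pos (hp m) (hβ.trans_le (ha i))
      nlinarith
    have h6 : (0 : ℝ) < m i + 1 := by positivity
    nlinarith

lemma cc_upper (a : Fin 3 → ℝ) (ha : ∀ i, 0 < a i) (m : Fin 3 →₀ ℕ) :
    cc a m ≤ (∑ i, a i) ^ m.degree := by
  have hnn : ∀ n (k : Fin 3 →₀ ℕ), 0 ≤ MvPolynomial.coeff k (ell a ^ n) := by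
    intro n k
    by_cases h : k.degree = n
    · subst h; exact (cc_pos a ha k).le
    · rw [coeff_ell_pow_ne a n k h]
  have h1 : MvPolynomial.eval (fun _ => (1 : ℝ)) (ell a ^ m.degree) = (∑ i, a i) ^ m.degree := by
    simp [ell]
  rw [← h1, MvPolynomial.eval_eq]
  simp only [one_pow, Finset.prod_const_one, mul_one]
  by_cases hm : m ∈ (ell a ^ m.degree).support
  · exact Finset.single_le_sum (f := fun k => MvPolynomial.coeff k (ell a ^ m.degree))
      (fun k _ => hnn _ k) hm
  · rw [cc, MvPolynomial.notMem_support_iff.1 hm]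
    exact Finset.sum_nonneg (fun k _ => hnn _ k)

lemma wt_pos (a : Fin 3 → ℝ) (ha : ∀ i, 0 < a i) (m : Fin 3 →₀ ℕ) : 0 < wt a m :=
  mul_pos (bb_pos _) (cc_pos a ha m)

lemma wt_rel (a : Fin 3 → ℝ) (m : Fin 3 →₀ ℕ) (i j : Fin 3) :
    wt a (m + single j 1) * (m j + 1) * a i = wt a (m + single i 1) * (m i + 1) * a j := by
  have h (i : Fin 3) : (m + single i 1).degree = m.degree + 1 := by simp [map_add]
  unfold wt
  rw [h, h]
  have h1 := cc_succ a m i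
  have h2 := cc_succ a m j
  linear_combination bb (m.degree + 1) * (a i * h2 - a j * h1)

lemma sum_inv_sq (n : ℕ) : ∑ i ∈ Finset.range (n + 1), 1 / ((i : ℝ) + 1) ^ 2 ≤ 2 - 1 / ((n : ℝ) + 1) := by
  induction n with
  | zero => norm_num
  | succ n ih =>
    rw [Finset.sum_range_succ]
    push_cast
    have : (1 : ℝ) / ((n : ℝ) + 1 + 1) ^ 2 ≤ 1 / ((n : ℝ) + 1) - 1 / ((n : ℝ) + 1 + 1) := by
      rw [div_sub_div _ _ (by positivity) (by positivity), div_le_div_iff₀ (by positivity) (by positivity)]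
      have : (0 : ℝ) ≤ n := by positivity
      nlinarith
    linarith

lemma bb_conv (n : ℕ) : ∑ p ∈ Finset.HasAntidiagonal.antidiagonal n, bb p.1 * bb p.2 ≤ bb n := by
  have hp : ∀ p ∈ Finset.HasAntidiagonal.antidiagonal n, bb p.1 * bb p.2 ≤
      bb n * (1 / 4 * (1 / ((p.1 : ℝ) + 1) ^ 2 + 1 / ((p.2 : ℝ) + 1) ^ 2)) := by
    intro p hp
    rw [Finset.HasAntidiagonal.mem_antidiagonal] at hp
    unfold bb
    have hn : (n : ℝ) = p.1 + p.2 := by rw [← hp]; push_cast; ring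
    rw [hn]
    have h1 : (0 : ℝ) ≤ p.1 := by positivity
    have h2 : (0 : ℝ) ≤ p.2 := by positivity
    generalize (p.1 : ℝ) = x at *
    generalize (p.2 : ℝ) = y at *
    rw [div_add_div _ _ (by positivity) (by positivity), div_mul_div_comm, div_mul_div_comm, div_mul_div_comm,
      div_le_div_iff₀ (by positivity) (by positivity)]
    have : (x + y + 1) ^ 2 ≤ 2 * ((x + 1) ^ 2 + (y + 1) ^ 2) := by nlinarith [sq_nonneg (x - y)]
    have h3 : 0 ≤ (x + 1) ^ 2 * (y + 1) ^ 2 := by positivity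
    nlinarith
  refine (Finset.sum_le_sum hp).trans ?_
  rw [← Finset.mul_sum, ← Finset.mul_sum, Finset.sum_add_distrib]
  have h1 : ∑ p ∈ Finset.HasAntidiagonal.antidiagonal n, 1 / ((p.1 : ℝ) + 1) ^ 2 ≤ 2 := by
    rw [Finset.Nat.sum_antidiagonal_eq_sum_range_succ_mk]
    refine (sum_inv_sq n).trans ?_
    have : (0 : ℝ) ≤ 1 / ((n : ℝ) + 1) := by positivity
    linarith
  have h2 : ∑ p ∈ Finset.HasAntidiagonal.antidiagonal n, 1 / ((p.2 : ℝ) + 1) ^ 2 ≤ 2 := by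
    rw [← Finset.Nat.sum_antidiagonal_swap]
    exact h1
  have := bb_pos n
  nlinarith

lemma wt_eq_sum (a : Fin 3 → ℝ) (m : Fin 3 →₀ ℕ) (n : ℕ) (h : m.degree ≤ n) :
    wt a m = ∑ k ∈ Finset.range (n + 1), bb k * MvPolynomial.coeff m (ell a ^ k) := by
  rw [Finset.sum_eq_single m.degree]
  · rfl
  · intro k _ hk
    rw [coeff_ell_pow_ne a k m (Ne.symm hk), mul_zero]
  · intro hc
    simp at hc; omega

lemma wt_conv (a : Fin 3 → ℝ) (ha : ∀ i, 0 < a i) (m : Fin 3 →₀ ℕ) :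
    ∑ p ∈ Finset.HasAntidiagonal.antidiagonal m, wt a p.1 * wt a p.2 ≤ wt a m := by
  have hd : ∀ p ∈ Finset.HasAntidiagonal.antidiagonal m, p.1.degree + p.2.degree = m.degree := by
    intro p hp
    rw [Finset.HasAntidiagonal.mem_antidiagonal] at hp
    rw [← map_add, hp]
  have h1 : ∑ p ∈ Finset.HasAntidiagonal.antidiagonal m, wt a p.1 * wt a p.2 =
      ∑ k ∈ Finset.range (m.degree + 1), ∑ l ∈ Finset.range (m.degree + 1),
        bb k * bb l * MvPolynomial.coeff m (ell a ^ (k + l)) := by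
    have : ∀ p ∈ Finset.HasAntidiagonal.antidiagonal m, wt a p.1 * wt a p.2 =
        ∑ k ∈ Finset.range (m.degree + 1), ∑ l ∈ Finset.range (m.degree + 1),
          bb k * bb l * (MvPolynomial.coeff p.1 (ell a ^ k) * MvPolynomial.coeff p.2 (ell a ^ l)) := by
      intro p hp
      have := hd p hp
      rw [wt_eq_sum a p.1 m.degree (by omega), wt_eq_sum a p.2 m.degree (by omega), Finset.sum_mul_sum]
      refine Finset.sum_congr rfl fun k _ => Finset.sum_congr rfl fun l _ => by ring
    rw [Finset.sum_congr rfl this, Finset.sum_comm]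
    refine Finset.sum_congr rfl fun k _ => ?_
    rw [Finset.sum_comm]
    refine Finset.sum_congr rfl fun l _ => ?_
    rw [← Finset.mul_sum, pow_add, MvPolynomial.coeff_mul]
  rw [h1]
  have h2 : ∀ k ∈ Finset.range (m.degree + 1), ∑ l ∈ Finset.range (m.degree + 1),
        bb k * bb l * MvPolynomial.coeff m (ell a ^ (k + l)) = bb k * bb (m.degree - k) * cc a m := by
    intro k hk
    simp at hk
    rw [Finset.sum_eq_single (m.degree - k)]
    · rw [cc]; congr 3; omega
    · intro l _ hl
      rw [coeff_ell_pow_ne, mul_zero]; omega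
    · intro hc
      simp at hc
  rw [Finset.sum_congr rfl h2, ← Finset.sum_mul,
    ← Finset.Nat.sum_antidiagonal_eq_sum_range_succ (fun k l => bb k * bb l)]
  exact mul_le_mul_of_nonneg_right (bb_conv _) (cc_pos a ha m).le

-- weighted bounds

/-- `f` is bounded by `K` in the weighted sup norm. -/
def Bd (a : Fin 3 → ℝ) (f : PS) (K : ℝ) : Prop := ∀ m, |coeff m f| ≤ K * wt a m

variable {a : Fin 3 → ℝ}

lemma Bd.nonneg (ha : ∀ i, 0 < a i) {f : PS} {K : ℝ} (h : Bd a f K) : 0 ≤ K := by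
  have h1 := (abs_nonneg _).trans (h 0)
  exact nonneg_of_mul_nonneg_left h1 (wt_pos a ha 0)

lemma Bd.mono (ha : ∀ i, 0 < a i) {f : PS} {K K' : ℝ} (h : Bd a f K) (hK : K ≤ K') : Bd a f K' :=
  fun m => (h m).trans (mul_le_mul_of_nonneg_right hK (wt_pos a ha m).le)

lemma Bd.add {f g : PS} {K K' : ℝ} (h : Bd a f K) (h' : Bd a g K') : Bd a (f + g) (K + K') := by
  intro m
  rw [map_add, add_mul]
  exact (abs_add_le _ _).trans (add_le_add (h m) (h' m))

lemma Bd.neg {f : PS} {K : ℝ} (h : Bd a f K) : Bd a (-f) K := by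
  intro m
  rw [map_neg, abs_neg]; exact h m

lemma Bd.sub {f g : PS} {K K' : ℝ} (h : Bd a f K) (h' : Bd a g K') : Bd a (f - g) (K + K') := by
  rw [sub_eq_add_neg]; exact h.add h'.neg

lemma Bd.mul (ha : ∀ i, 0 < a i) {f g : PS} {K K' : ℝ} (h : Bd a f K) (h' : Bd a g K') :
    Bd a (f * g) (K * K') := by
  intro m
  rw [MvPowerSeries.coeff_mul]
  calc |∑ p ∈ Finset.HasAntidiagonal.antidiagonal m, coeff p.1 f * coeff p.2 g|
      ≤ ∑ p ∈ Finset.HasAntidiagonal.antidiagonal m, |coeff p.1 f * coeff p.2 g| := Finset.abs_sum_le_sum_abs _ _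
    _ ≤ ∑ p ∈ Finset.HasAntidiagonal.antidiagonal m, K * K' * (wt a p.1 * wt a p.2) := by
        refine Finset.sum_le_sum fun p _ => ?_
        rw [abs_mul]
        have := mul_le_mul (h p.1) (h' p.2) (abs_nonneg _) ((abs_nonneg _).trans (h p.1))
        linarith
    _ = K * K' * ∑ p ∈ Finset.HasAntidiagonal.antidiagonal m, wt a p.1 * wt a p.2 := by rw [Finset.mul_sum]
    _ ≤ K * K' * wt a m := by
        exact mul_le_mul_of_nonneg_left (wt_conv a ha m) (mul_nonneg (h.nonneg ha) (h'.nonneg ha))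

/-- bound on a product with a differentiated factor. -/
lemma coeff_mul_dd_le (ha : ∀ i, 0 < a i) {f g : PS} {K K' : ℝ} (h : Bd a f K) (h' : Bd a g K')
    (j : Fin 3) (m : Fin 3 →₀ ℕ) :
    |coeff m (f * dd j g)| ≤ K * K' * (wt a (m + single j 1) * (m j + 1)) := by
  rw [MvPowerSeries.coeff_mul]
  have hKK : 0 ≤ K * K' := mul_nonneg (h.nonneg ha) (h'.nonneg ha)
  calc |∑ p ∈ Finset.HasAntidiagonal.antidiagonal m, coeff p.1 f * coeff p.2 (dd j g)|
      ≤ ∑ p ∈ Finset.HasAntidiagonal.antidiagonal m, |coeff p.1 f * coeff p.2 (dd j g)| :=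
        Finset.abs_sum_le_sum_abs _ _
    _ ≤ ∑ p ∈ Finset.HasAntidiagonal.antidiagonal m, K * K' * (wt a p.1 * wt a (p.2 + single j 1)) * (m j + 1) := by
        refine Finset.sum_le_sum fun p hp => ?_
        rw [Finset.HasAntidiagonal.mem_antidiagonal] at hp
        rw [abs_mul, coeff_dd, abs_mul]
        have h1 := mul_le_mul (h p.1) (h' (p.2 + single j 1)) (abs_nonneg _)
          ((abs_nonneg _).trans (h p.1))
        have h2 : (p.2 j : ℝ) + 1 ≤ m j + 1 := by
          rw [← hp]; simp
        have h3 : |(p.2 j : ℝ) + 1| = p.2 j + 1 := abs_of_nonneg (by positivity)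
        rw [h3, ← mul_assoc]
        refine mul_le_mul (h1.trans (le_of_eq (by ring))) h2 (by positivity) ?_
        have := wt_pos a ha p.1
        have := wt_pos a ha (p.2 + single j 1)
        positivity
    _ = K * K' * ((∑ p ∈ Finset.HasAntidiagonal.antidiagonal m, wt a p.1 * wt a (p.2 + single j 1)) * (m j + 1)) := by
        rw [Finset.sum_mul, Finset.mul_sum]
        exact Finset.sum_congr rfl fun p _ => by ring
    _ ≤ K * K' * (wt a (m + single j 1) * (m j + 1)) := by
        refine mul_le_mul_of_nonneg_left (mul_le_mul_of_nonneg_right ?_ (by positivity)) hKK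
        refine le_trans ?_ (wt_conv a ha (m + single j 1))
        have hinj : Set.InjOn (fun p : (Fin 3 →₀ ℕ) × (Fin 3 →₀ ℕ) => (p.1, p.2 + single j 1))
            (Finset.HasAntidiagonal.antidiagonal m) := by
          intro p _ q _ hpq
          simp at hpq
          exact Prod.ext hpq.1 hpq.2
        rw [← Finset.sum_image (f := fun p => wt a p.1 * wt a p.2) hinj]
        refine Finset.sum_le_sum_of_subset_of_nonneg ?_ ?_
        · intro p hp
          simp only [Finset.mem_image, Finset.HasAntidiagonal.mem_antidiagonal] at hp ⊢
          obtain ⟨q, hq, rfl⟩ := hp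
          simp [← hq, add_assoc]
        · intro p _ _
          exact (mul_pos (wt_pos a ha _) (wt_pos a ha _)).le

lemma Bd.JJ_of (ha : ∀ i, 0 < a i) {g : PS} {C ε : ℝ} (hC : 0 ≤ C) {i j : Fin 3} (hε : a j ≤ ε * a i)
    (h : ∀ m, |coeff m g| ≤ C * (wt a (m + single j 1) * (m j + 1))) : Bd a (JJ i g) (ε * C) := by
  have hε0 : 0 < ε := by
    have := (ha j).trans_le hε
    exact pos_of_mul_pos_left this (ha i).le
  intro m
  by_cases hm : m i = 0
  · rw [coeff_JJ_zero _ _ _ hm, abs_zero]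
    exact mul_nonneg (mul_nonneg hε0.le hC) (wt_pos a ha m).le
  · obtain ⟨m, rfl⟩ := exists_pred i m hm
    rw [coeff_JJ_succ, abs_div, abs_of_nonneg (by positivity : (0 : ℝ) ≤ m i + 1),
      div_le_iff₀ (by positivity)]
    refine (h m).trans ?_
    rw [mul_comm ε C, mul_assoc, mul_assoc]
    refine mul_le_mul_of_nonneg_left ?_ hC
    have h1 := wt_rel a m i j
    have h2 := wt_pos a ha (m + single i 1)
    have h3 : 0 < wt a (m + single i 1) * (m i + 1) := by positivity
    have := ha i
    refine le_of_mul_le_mul_right ?_ this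
    rw [h1]
    nlinarith

lemma Bd.JJ_mul_dd (ha : ∀ i, 0 < a i) {f g : PS} {K K' ε : ℝ} (h : Bd a f K) (h' : Bd a g K')
    {i j : Fin 3} (hε : a j ≤ ε * a i) : Bd a (JJ i (f * dd j g)) (ε * (K * K')) :=
  Bd.JJ_of ha (mul_nonneg (h.nonneg ha) (h'.nonneg ha)) hε (coeff_mul_dd_le ha h h' j)

lemma Bd.JJ_dd (ha : ∀ i, 0 < a i) {g : PS} {K ε : ℝ} (h : Bd a g K)
    {i j : Fin 3} (hε : a j ≤ ε * a i) : Bd a (JJ i (dd j g)) (ε * K) := by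
  refine Bd.JJ_of ha (h.nonneg ha) hε fun m => ?_
  rw [coeff_dd, abs_mul, abs_of_nonneg (by positivity : (0 : ℝ) ≤ m j + 1), ← mul_assoc]
  exact mul_le_mul_of_nonneg_right (h _) (by positivity)

end CK


namespace CK

open MvPowerSeries Finsupp

abbrev Tup := Fin 10 → PS

/-- boundedness and Lipschitz bound on the ball of radius `ρ`. -/
def LB (a : Fin 3 → ℝ) (ρ : ℝ) (F : Tup → PS) (K : ℝ) : Prop :=
  (∀ f : Tup, (∀ i, Bd a (f i) ρ) → Bd a (F f) K) ∧
  (∀ (f g : Tup) (δ : ℝ), (∀ i, Bd a (f i) ρ) → (∀ i, Bd a (g i) ρ) →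
    (∀ i, Bd a (f i - g i) δ) → Bd a (F f - F g) (K * δ))

/-- admissible weights. -/
structure Adm (β ε : ℝ) (a : Fin 3 → ℝ) : Prop where
  eps_pos : 0 < ε
  eps_le : ε ≤ 1
  beta_pos : 0 < β
  le1 : β ≤ a 1
  h10 : a 1 ≤ ε * a 0
  h12 : a 1 ≤ ε * a 2
  h02 : a 0 ≤ ε * a 2
  hx : 32 ≤ ε * a 1

lemma Adm.le {β ε : ℝ} {a : Fin 3 → ℝ} (h : Adm β ε a) (i : Fin 3) : β ≤ a i := by
  have h0 := h.eps_pos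
  have h1 := h.eps_le
  have h2 := h.beta_pos
  have h3 := h.le1
  have ha0 : 0 < a 0 := pos_of_mul_pos_right ((h2.trans_le h3).trans_le h.h10) h0.le
  have ha2 : 0 < a 2 := pos_of_mul_pos_right ((h2.trans_le h3).trans_le h.h12) h0.le
  have := h.h10
  have := h.h12
  fin_cases i
  · show β ≤ a 0; nlinarith
  · exact h3
  · show β ≤ a 2; nlinarith

lemma Adm.pos {β ε : ℝ} {a : Fin 3 → ℝ} (h : Adm β ε a) (i : Fin 3) : 0 < a i :=
  h.beta_pos.trans_le (h.le i)

lemma exists_adm (β ε : ℝ) (hβ : 0 < β) (hε : 0 < ε) (hε1 : ε ≤ 1) : ∃ a, Adm β ε a := by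
  set b := max β (32 / ε) with hb
  have hb1 : β ≤ b := le_max_left _ _
  have hb2 : 32 / ε ≤ b := le_max_right _ _
  have hbp : 0 < b := hβ.trans_le hb1
  refine ⟨![b / ε, b, b / ε / ε], hε, hε1, hβ, hb1, ?_, ?_, ?_, ?_⟩
  · simp; field_simp; rfl
  · simp
    field_simp; assumption
  · simp; field_simp; rfl
  · simp
    rw [div_le_iff₀ hε] at hb2; linarith

def UL (β ρ : ℝ) (F : Tup → PS) : Prop :=
  ∃ K, 0 ≤ K ∧ ∀ ε a, Adm β ε a → LB a ρ F K

def SL (β ρ : ℝ) (F : Tup → PS) : Prop :=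
  ∃ K, 0 ≤ K ∧ ∀ ε a, Adm β ε a → LB a ρ F (ε * K)

lemma LB.mono {a : Fin 3 → ℝ} (ha : ∀ i, 0 < a i) {ρ : ℝ} {F : Tup → PS} {K K' : ℝ} (h : LB a ρ F K)
    (hK : K ≤ K') : LB a ρ F K' := by
  refine ⟨fun f hf => (h.1 f hf).mono ha hK, fun f g δ hf hg hd => (h.2 f g δ hf hg hd).mono ha ?_⟩
  exact mul_le_mul_of_nonneg_right hK ((hd 0).nonneg ha)

lemma LB.add {a : Fin 3 → ℝ} {ρ : ℝ} {F G : Tup → PS} {K K' : ℝ} (h : LB a ρ F K)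
    (h' : LB a ρ G K') : LB a ρ (fun f => F f + G f) (K + K') := by
  refine ⟨fun f hf => (h.1 f hf).add (h'.1 f hf), fun f g δ hf hg hd => ?_⟩
  have := (h.2 f g δ hf hg hd).add (h'.2 f g δ hf hg hd)
  rw [← add_mul] at this
  convert this using 1
  ring

lemma LB.neg {a : Fin 3 → ℝ} {ρ : ℝ} {F : Tup → PS} {K : ℝ} (h : LB a ρ F K) :
    LB a ρ (fun f => - F f) K := by
  refine ⟨fun f hf => (h.1 f hf).neg, fun f g δ hf hg hd => ?_⟩
  have := (h.2 f g δ hf hg hd).neg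
  convert this using 1
  ring

lemma LB.mul {a : Fin 3 → ℝ} (ha : ∀ i, 0 < a i) {ρ : ℝ} {F G : Tup → PS} {K K' : ℝ} (h : LB a ρ F K)
    (h' : LB a ρ G K') (hK : 0 ≤ K * K') : LB a ρ (fun f => F f * G f) (2 * (K * K')) := by
  refine ⟨fun f hf => ((h.1 f hf).mul ha (h'.1 f hf)).mono ha (by linarith), fun f g δ hf hg hd => ?_⟩
  have := ((h.2 f g δ hf hg hd).mul ha (h'.1 f hf)).add ((h.1 g hg).mul ha (h'.2 f g δ hf hg hd))
  convert this using 1 <;> ring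

lemma LB.JJ_dd {a : Fin 3 → ℝ} (ha : ∀ i, 0 < a i) {ρ : ℝ} {F : Tup → PS} {K ε : ℝ} (h : LB a ρ F K)
    {i j : Fin 3} (hε : a j ≤ ε * a i) : LB a ρ (fun f => JJ i (dd j (F f))) (ε * K) := by
  refine ⟨fun f hf => (h.1 f hf).JJ_dd ha hε, fun f g δ hf hg hd => ?_⟩
  have := (h.2 f g δ hf hg hd).JJ_dd ha hε
  rw [dd_sub, JJ_sub] at this
  convert this using 1; ring

lemma LB.JJ_mul_dd {a : Fin 3 → ℝ} (ha : ∀ i, 0 < a i) {ρ : ℝ} {F G : Tup → PS} {K K' ε : ℝ}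
    (h : LB a ρ F K) (h' : LB a ρ G K') (hK : 0 ≤ K * K')
    {i j : Fin 3} (hε : a j ≤ ε * a i) :
    LB a ρ (fun f => JJ i (F f * dd j (G f))) (ε * (2 * (K * K'))) := by
  have hε0 : 0 < ε := pos_of_mul_pos_left ((ha j).trans_le hε) (ha i).le
  refine ⟨fun f hf => ((h.1 f hf).JJ_mul_dd ha (h'.1 f hf) hε).mono ha ?_, fun f g δ hf hg hd => ?_⟩
  · exact mul_le_mul_of_nonneg_left (by linarith) hε0.le
  have := ((h.2 f g δ hf hg hd).JJ_mul_dd ha (h'.1 f hf) hε).add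
    ((h.1 g hg).JJ_mul_dd ha (h'.2 f g δ hf hg hd) hε)
  convert this using 1
  · rw [← JJ_sub, ← JJ_add]
    congr 1
    rw [dd_sub]
    ring
  · ring

variable {β ρ : ℝ} {F G : Tup → PS}

lemma SL.ul (h : SL β ρ F) : UL β ρ F := by
  obtain ⟨K, hK, h⟩ := h
  refine ⟨K, hK, fun ε a ha => (h ε a ha).mono ha.pos ?_⟩
  have := ha.eps_le
  nlinarith

lemma UL.add (h : UL β ρ F) (h' : UL β ρ G) : UL β ρ (fun f => F f + G f) := by
  obtain ⟨K, hK, h⟩ := h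
  obtain ⟨K', hK', h'⟩ := h'
  exact ⟨K + K', by positivity, fun ε a ha => (h ε a ha).add (h' ε a ha)⟩

lemma UL.neg (h : UL β ρ F) : UL β ρ (fun f => - F f) := by
  obtain ⟨K, hK, h⟩ := h
  exact ⟨K, hK, fun ε a ha => (h ε a ha).neg⟩

lemma UL.sub (h : UL β ρ F) (h' : UL β ρ G) : UL β ρ (fun f => F f - G f) := by
  simp only [sub_eq_add_neg]; exact h.add h'.neg

lemma UL.mul (h : UL β ρ F) (h' : UL β ρ G) : UL β ρ (fun f => F f * G f) := by
  obtain ⟨K, hK, h⟩ := h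
  obtain ⟨K', hK', h'⟩ := h'
  exact ⟨2 * (K * K'), by positivity, fun ε a ha => (h ε a ha).mul ha.pos (h' ε a ha) (by positivity)⟩

lemma SL.add (h : SL β ρ F) (h' : SL β ρ G) : SL β ρ (fun f => F f + G f) := by
  obtain ⟨K, hK, h⟩ := h
  obtain ⟨K', hK', h'⟩ := h'
  refine ⟨K + K', by positivity, fun ε a ha => ?_⟩
  rw [mul_add]
  exact (h ε a ha).add (h' ε a ha)

lemma SL.neg (h : SL β ρ F) : SL β ρ (fun f => - F f) := by
  obtain ⟨K, hK, h⟩ := h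
  exact ⟨K, hK, fun ε a ha => (h ε a ha).neg⟩

lemma SL.sub (h : SL β ρ F) (h' : SL β ρ G) : SL β ρ (fun f => F f - G f) := by
  simp only [sub_eq_add_neg]; exact h.add h'.neg

lemma SL.mul (h : SL β ρ F) (h' : UL β ρ G) : SL β ρ (fun f => F f * G f) := by
  obtain ⟨K, hK, h⟩ := h
  obtain ⟨K', hK', h'⟩ := h'
  refine ⟨2 * (K * K'), by positivity, fun ε a ha => ?_⟩
  have := ha.eps_pos
  have := (h ε a ha).mul ha.pos (h' ε a ha) (by positivity)
  convert this using 1; ring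

lemma SL.mul' (h : UL β ρ F) (h' : SL β ρ G) : SL β ρ (fun f => F f * G f) := by
  simpa only [mul_comm] using h'.mul h

lemma Adm.ij {ε : ℝ} {a : Fin 3 → ℝ} (ha : Adm β ε a) {i j : Fin 3} (hij : (i = 0 ∧ j = 1) ∨ (i = 2 ∧ j ≠ 2)) :
    a j ≤ ε * a i := by
  obtain ⟨rfl, rfl⟩ | ⟨rfl, h⟩ := hij
  · exact ha.h10
  · fin_cases j
    · exact ha.h02
    · exact ha.h12
    · simp at h

lemma SL.JJ_dd (i j : Fin 3) (hij : (i = 0 ∧ j = 1) ∨ (i = 2 ∧ j ≠ 2)) (h : UL β ρ F) :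
    SL β ρ (fun f => JJ i (dd j (F f))) := by
  obtain ⟨K, hK, h⟩ := h
  exact ⟨K, hK, fun ε a ha => (h ε a ha).JJ_dd ha.pos (ha.ij hij)⟩

lemma SL.JJ_mul_dd (i j : Fin 3) (hij : (i = 0 ∧ j = 1) ∨ (i = 2 ∧ j ≠ 2)) (h : UL β ρ F) (h' : UL β ρ G) :
    SL β ρ (fun f => JJ i (F f * dd j (G f))) := by
  obtain ⟨K, hK, h⟩ := h
  obtain ⟨K', hK', h'⟩ := h'
  exact ⟨2 * (K * K'), by positivity,
    fun ε a ha => (h ε a ha).JJ_mul_dd ha.pos (h' ε a ha) (by positivity) (ha.ij hij)⟩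

lemma UL.proj (hρ : 0 ≤ ρ) (i : Fin 10) : UL β ρ (fun f => f i) := by
  refine ⟨ρ + 1, by positivity, fun ε a ha => ⟨fun f hf => (hf i).mono ha.pos (by linarith),
    fun f g δ _ _ hd => (hd i).mono ha.pos ?_⟩⟩
  have := (hd 0).nonneg ha.pos
  nlinarith

lemma Bd.zero {a : Fin 3 → ℝ} (ha : ∀ i, 0 < a i) {K : ℝ} (hK : 0 ≤ K) : Bd a 0 K := by
  intro m
  simpa using mul_nonneg hK (wt_pos a ha m).le

lemma UL.const (c : PS) (A : ℝ) (hA : 0 ≤ A) (h : ∀ ε a, Adm β ε a → Bd a c A) : UL β ρ (fun _ => c) := by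
  refine ⟨A, hA, fun ε a ha => ⟨fun f hf => h ε a ha, fun f g δ _ _ hd => ?_⟩⟩
  rw [sub_self]
  exact Bd.zero ha.pos (mul_nonneg hA ((hd 0).nonneg ha.pos))

lemma bd_one {a : Fin 3 → ℝ} (ha : ∀ i, 0 < a i) : Bd a 1 8 := by
  classical
  intro m
  rw [coeff_one]
  split_ifs with h
  · subst h; simp [wt, bb, cc_zero]
  · simpa using (wt_pos a ha m).le

lemma UL.one : UL β ρ (fun _ => 1) := UL.const 1 8 (by norm_num) (fun _ _ ha => bd_one ha.pos)

lemma bd_X {ε : ℝ} {a : Fin 3 → ℝ} (ha : Adm β ε a) : Bd a (X 1) ε := by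
  classical
  intro m
  rw [coeff_X]
  split_ifs with h
  · subst h
    have h1 := cc_succ a 0 1
    simp [cc_zero] at h1
    have h2 := ha.hx
    simp [wt, bb, h1]
    norm_num
    linarith
  · simpa using mul_nonneg ha.eps_pos.le (wt_pos a ha.pos m).le

lemma SL.X : SL β ρ (fun _ => X 1) := by
  refine ⟨1, by positivity, fun ε a ha => ⟨fun f hf => ?_, fun f g δ _ _ hd => ?_⟩⟩
  · rw [mul_one]; exact bd_X ha
  · rw [sub_self]
    exact Bd.zero ha.pos (mul_nonneg (by have := ha.eps_pos; positivity) ((hd 0).nonneg ha.pos))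

/-- Banach fixed point. -/
lemma fixed_point {a : Fin 3 → ℝ} (ha : ∀ i, 0 < a i) {ρ : ℝ} (hρ : 0 ≤ ρ) (T : Tup → Tup)
    (hball : ∀ f : Tup, (∀ i, Bd a (f i) ρ) → ∀ i, Bd a (T f i) ρ)
    (hlip : ∀ (f g : Tup) (δ : ℝ), (∀ i, Bd a (f i) ρ) → (∀ i, Bd a (g i) ρ) →
      (∀ i, Bd a (f i - g i) δ) → ∀ i, Bd a (T f i - T g i) (1 / 2 * δ)) :
    ∃ f : Tup, (∀ i, Bd a (f i) ρ) ∧ T f = f := by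
  let s : ℕ → Tup := fun n => T^[n] 0
  have hs (n : ℕ) : s (n + 1) = T (s n) := Function.iterate_succ_apply' T n 0
  have hb : ∀ n i, Bd a (s n i) ρ := by
    intro n
    induction n with
    | zero => intro i; exact Bd.zero ha hρ
    | succ n ih => rw [hs]; exact hball _ ih
  have hd : ∀ n i, Bd a (s n i - s (n + 1) i) ((2 * ρ) * (1 / 2) ^ n) := by
    intro n
    induction n with
    | zero => intro i; exact ((hb 0 i).sub (hb 1 i)).mono ha (by linarith)
    | succ n ih =>
      intro i
      rw [hs (n + 1)]
      nth_rw 1 [hs n]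
      have := hlip _ _ _ (hb n) (hb (n + 1)) ih i
      refine this.mono ha (le_of_eq ?_)
      ring
  have hdist : ∀ i m n, dist (coeff m (s n i)) (coeff m (s (n + 1) i)) ≤ (2 * ρ * wt a m) * (1 / 2) ^ n := by
    intro i m n
    have := hd n i m
    rw [map_sub] at this
    rw [Real.dist_eq]
    linarith
  have hlim : ∀ i m, ∃ x, Filter.Tendsto (fun n => coeff m (s n i)) Filter.atTop (nhds x) := fun i m =>
    cauchySeq_tendsto_of_complete (cauchySeq_of_le_geometric _ _ (by norm_num) (hdist i m))
  choose x hx using hlim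
  let f : Tup := fun i => (fun m => x i m)
  have hfc : ∀ i m, coeff m (f i) = x i m := fun i m => rfl
  have hfb : ∀ i, Bd a (f i) ρ := by
    intro i m
    rw [hfc]
    exact le_of_tendsto' (hx i m).abs fun n => hb n i m
  have hfd : ∀ n i, Bd a (s n i - f i) (4 * ρ * (1 / 2) ^ n) := by
    intro n i m
    have := dist_le_of_le_geometric_of_tendsto _ _ (by norm_num) (hdist i m) (hx i m) n
    rw [Real.dist_eq] at this
    rw [map_sub, hfc]
    refine this.trans (le_of_eq ?_)
    ring
  refine ⟨f, hfb, ?_⟩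
  funext i
  ext m
  have h1 : ∀ n, |coeff m (T f i) - coeff m (f i)| ≤ (4 * ρ * wt a m) * (1 / 2) ^ n := by
    intro n
    have e1 := hlip _ _ _ (hb n) hfb (hfd n) i m
    have e2 := hfd (n + 1) i m
    rw [hs n] at e2
    rw [map_sub] at e1 e2
    rw [abs_le] at e1 e2 ⊢
    rw [pow_succ] at e2
    constructor <;> linarith [e1.1, e1.2, e2.1, e2.2]
  have h2 : Filter.Tendsto (fun n : ℕ => (4 * ρ * wt a m) * (1 / 2 : ℝ) ^ n) Filter.atTop (nhds 0) := by
    simpa using (tendsto_pow_atTop_nhds_zero_of_lt_one (r := (1 / 2 : ℝ)) (by norm_num) (by norm_num)).const_mul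
      (4 * ρ * wt a m)
  have h3 := ge_of_tendsto' h2 h1
  have h4 := abs_nonpos_iff.1 h3
  linarith

lemma solve (β ρ : ℝ) (hβ : 0 < β) (c : Tup) (S : Fin 10 → Tup → PS)
    (hρ : 1 ≤ ρ) (hc : ∀ i ε a, Adm β ε a → Bd a (c i) (ρ - 1)) (hS : ∀ i, SL β ρ (S i)) :
    ∃ a : Fin 3 → ℝ, (∀ i, 0 < a i) ∧ ∃ f : Tup, (∀ i, Bd a (f i) ρ) ∧ ∀ i, f i = c i + S i f := by
  choose K hK hS using hS
  set k := ∑ i, K i with hk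
  have hKk : ∀ i, K i ≤ k := fun i => Finset.single_le_sum (fun j _ => hK j) (Finset.mem_univ i)
  have hk0 : 0 ≤ k := Finset.sum_nonneg fun j _ => hK j
  set ε : ℝ := 1 / (2 * (k + 1)) with hε
  have hεp : 0 < ε := by positivity
  have hε1 : ε ≤ 1 := by
    rw [hε, div_le_iff₀ (by positivity)]; linarith
  have hεk : ε * k ≤ 1 / 2 := by
    rw [hε, div_mul_eq_mul_div, div_le_div_iff₀ (by positivity) (by norm_num)]; linarith
  obtain ⟨a, ha⟩ := exists_adm β ε hβ hεp hε1
  have hL : ∀ i, LB a ρ (S i) (1 / 2) := fun i => (hS i ε a ha).mono ha.pos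
    ((mul_le_mul_of_nonneg_left (hKk i) hεp.le).trans hεk)
  refine ⟨a, ha.pos, ?_⟩
  have h1 : ∀ f : Tup, (∀ i, Bd a (f i) ρ) → ∀ i, Bd a ((fun f i => c i + S i f : Tup → Tup) f i) ρ := by
    intro f hf i
    exact ((hc i ε a ha).add ((hL i).1 f hf)).mono ha.pos (by linarith)
  obtain ⟨f, hf, hT⟩ := fixed_point (ρ := ρ) ha.pos (by linarith) (fun f i => c i + S i f) h1 (by
    intro f g δ hf hg hd i
    have := (hL i).2 f g δ hf hg hd
    simpa only [add_sub_add_left_eq_sub] using this)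
  exact ⟨f, hf, fun i => (congrFun hT i).symm⟩

end CK

namespace CK
open MvPowerSeries Finsupp

noncomputable def ss (f : Tup) : Tup := ![
  - JJ 2 (dd 1 (f 3 - f 0 * f 1)),
  - JJ 2 (dd 0 (f 0 * f 1)) - JJ 2 (dd 1 (f 1 * f 1 - f 0 * f 0 + f 2)),
  JJ 0 (dd 1 (f 3 - (f 0 * f 1 + f 0 * f 1))),
  JJ 0 (dd 1 (f 0 * f 0 - f 1 * f 1 - f 2)),
  -(JJ 0 (dd 1 (f 3 - (f 0 * f 1 + f 0 * f 1))) * f 4),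
  X 1 + JJ 0 (-(f 0 * f 1 * f 4) * dd 1 (f 5)) + JJ 0 (f 4 * f 9 * dd 1 (f 8)),
  JJ 0 (-(f 0 * f 1 * f 4) * dd 1 (f 6)) - JJ 0 (f 4 * f 9 * dd 1 (f 7)),
  X 1 + JJ 0 (-(f 0 * f 1 * f 4) * dd 1 (f 7))
    + JJ 0 ((f 1 * f 1 - f 0 * f 0 + f 2 - f 0 * f 1 * (f 0 * f 1) * f 4) * (1 + f 7 * f 7 + f 8 * f 8) * dd 1 (f 6)),
  JJ 0 (-(f 0 * f 1 * f 4) * dd 1 (f 8))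
    - JJ 0 ((f 1 * f 1 - f 0 * f 0 + f 2 - f 0 * f 1 * (f 0 * f 1) * f 4) * (1 + f 7 * f 7 + f 8 * f 8) * dd 1 (f 5)),
  -((f 7 * (X 1 + JJ 0 (-(f 0 * f 1 * f 4) * dd 1 (f 7))
    + JJ 0 ((f 1 * f 1 - f 0 * f 0 + f 2 - f 0 * f 1 * (f 0 * f 1) * f 4) * (1 + f 7 * f 7 + f 8 * f 8) * dd 1 (f 6)))
    + f 8 * (JJ 0 (-(f 0 * f 1 * f 4) * dd 1 (f 8))
    - JJ 0 ((f 1 * f 1 - f 0 * f 0 + f 2 - f 0 * f 1 * (f 0 * f 1) * f 4) * (1 + f 7 * f 7 + f 8 * f 8) * dd 1 (f 5)))) * f 9)]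

lemma ss_SL (β ρ : ℝ) (hρ : 0 ≤ ρ) (i : Fin 10) : SL β ρ (fun f => ss f i) := by
  have p := fun i => UL.proj (β := β) hρ i
  have h01 : ((0 : Fin 3) = 0 ∧ (1 : Fin 3) = 1) ∨ ((0 : Fin 3) = 2 ∧ (1 : Fin 3) ≠ 2) := by decide
  have h20 : ((2 : Fin 3) = 0 ∧ (0 : Fin 3) = 1) ∨ ((2 : Fin 3) = 2 ∧ (0 : Fin 3) ≠ 2) := by decide
  have h21 : ((2 : Fin 3) = 0 ∧ (1 : Fin 3) = 1) ∨ ((2 : Fin 3) = 2 ∧ (1 : Fin 3) ≠ 2) := by decide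
  have uv := (p 0).mul (p 1)
  have m := (uv.mul (p 4)).neg
  have Le := (((p 1).mul (p 1)).sub ((p 0).mul (p 0))).add (p 2)
  have Ze := (p 3).sub (uv.add uv)
  have k := (Le.sub ((uv.mul uv).mul (p 4))).mul
    ((UL.one.add ((p 7).mul (p 7))).add ((p 8).mul (p 8)))
  have qW := (p 4).mul (p 9)
  have P := (SL.X.add (SL.JJ_mul_dd 0 1 h01 m (p 7))).add (SL.JJ_mul_dd 0 1 h01 k (p 6))
  have Q := (SL.JJ_mul_dd 0 1 h01 m (p 8)).sub (SL.JJ_mul_dd 0 1 h01 k (p 5))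
  fin_cases i
  · exact (SL.JJ_dd 2 1 h21 ((p 3).sub uv)).neg
  · exact (SL.JJ_dd 2 0 h20 uv).neg.sub (SL.JJ_dd 2 1 h21 Le)
  · exact SL.JJ_dd 0 1 h01 Ze
  · exact SL.JJ_dd 0 1 h01 ((((p 0).mul (p 0)).sub ((p 1).mul (p 1))).sub (p 2))
  · exact ((SL.JJ_dd 0 1 h01 Ze).mul (p 4)).neg
  · exact (SL.X.add (SL.JJ_mul_dd 0 1 h01 m (p 5))).add (SL.JJ_mul_dd 0 1 h01 qW (p 8))
  · exact (SL.JJ_mul_dd 0 1 h01 m (p 6)).sub (SL.JJ_mul_dd 0 1 h01 qW (p 7))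
  · exact P
  · exact Q
  · exact (((SL.mul' (p 7) P).add (SL.mul' (p 8) Q)).mul (p 9)).neg

lemma cst_JJ (i : Fin 3) (f : PS) : constantCoeff (JJ i f) = 0 := by
  rw [← coeff_zero_eq_constantCoeff_apply]
  exact coeff_JJ_zero i f 0 rfl

/-- `f` restricted to `x₁ = 0`. -/
lemma system (U0 V0 : PS) (β A : ℝ) (hβ : 0 < β) (hA : 0 ≤ A)
    (hU : ∀ ε a, Adm β ε a → Bd a U0 A) (hV : ∀ ε a, Adm β ε a → Bd a V0 A) 
    (hU2 : dd 2 U0 = 0) (hV2 : dd 2 V0 = 0) (hd : dd 0 U0 + dd 1 V0 = 0) :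
    ∃ a : Fin 3 → ℝ, (∀ i, 0 < a i) ∧ ∃ ρ, ∃ f : Tup, (∀ i, Bd a (f i) ρ) ∧
      ∃ u v N x y P Q W : PS, u = f 0 ∧ v = f 1 ∧ N = f 2 ∧ x = f 5 ∧ y = f 6 ∧ P = f 7 ∧ Q = f 8 ∧ W = f 9 ∧
      (∀ m : Fin 3 →₀ ℕ, m 2 = 0 → coeff m u = coeff m U0) ∧
      (∀ m : Fin 3 →₀ ℕ, m 2 = 0 → coeff m v = coeff m V0) ∧
      dd 2 u = -(dd 0 N + dd 1 (u * v)) ∧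
      dd 2 v = -(dd 0 (u * v) + dd 1 (v * v - u * u + N)) ∧
      dd 0 u + dd 1 v = 0 ∧
      N * dd 0 x + (u * v) * dd 1 x = W * dd 1 Q ∧
      N * dd 0 y + (u * v) * dd 1 y = - (W * dd 1 P) ∧
      dd 0 P = (1 + P * P + Q * Q) * ((v * v - u * u + N) * dd 1 y + u * v * dd 0 y) ∧
      dd 0 Q = (1 + P * P + Q * Q) * (-(v * v - u * u + N) * dd 1 x - u * v * dd 0 x) ∧
      W * (1 + P * P + Q * Q) = 1 ∧
      constantCoeff (dd 0 x * dd 1 y - dd 1 x * dd 0 y) = 1 := by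
  have hc : ∀ i ε a, Adm β ε a → Bd a ((![U0, V0, 1, 0, 1, 0, 0, 0, 0, 1] : Tup) i) (A + 9 - 1) := by
    intro i ε a had
    have hz : Bd a 0 (A + 9 - 1) := Bd.zero had.pos (by linarith)
    have ho : Bd a 1 (A + 9 - 1) := (bd_one had.pos).mono had.pos (by linarith)
    fin_cases i
    · exact (hU ε a had).mono had.pos (by linarith)
    · exact (hV ε a had).mono had.pos (by linarith)
    · exact ho
    · exact hz
    · exact ho
    · exact hz
    · exact hz
    · exact hz
    · exact hz
    · exact ho
  obtain ⟨a, ha, f, hf, hE⟩ := solve β (A + 9) hβ ![U0, V0, 1, 0, 1, 0, 0, 0, 0, 1] (fun i f => ss f i)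
    (by linarith) hc (ss_SL β _ (by linarith))
  · refine ⟨a, ha, A + 9, f, hf, f 0, f 1, f 2, f 5, f 6, f 7, f 8, f 9, rfl, rfl, rfl, rfl, rfl, rfl, rfl, rfl, ?_⟩
    have e0 : f 0 = U0 + - JJ 2 (dd 1 (f 3 - f 0 * f 1)) := hE 0
    have e1 : f 1 = V0 + (- JJ 2 (dd 0 (f 0 * f 1)) - JJ 2 (dd 1 (f 1 * f 1 - f 0 * f 0 + f 2))) := hE 1
    have e2 : f 2 = 1 + JJ 0 (dd 1 (f 3 - (f 0 * f 1 + f 0 * f 1))) := hE 2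
    have e3 : f 3 = 0 + JJ 0 (dd 1 (f 0 * f 0 - f 1 * f 1 - f 2)) := hE 3
    have e4 : f 4 = 1 + -(JJ 0 (dd 1 (f 3 - (f 0 * f 1 + f 0 * f 1))) * f 4) := hE 4
    have e5 : f 5 = 0 + (X 1 + JJ 0 (-(f 0 * f 1 * f 4) * dd 1 (f 5)) + JJ 0 (f 4 * f 9 * dd 1 (f 8))) := hE 5
    have e6 : f 6 = 0 + (JJ 0 (-(f 0 * f 1 * f 4) * dd 1 (f 6)) - JJ 0 (f 4 * f 9 * dd 1 (f 7))) := hE 6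
    have e7 : f 7 = 0 + (X 1 + JJ 0 (-(f 0 * f 1 * f 4) * dd 1 (f 7))
      + JJ 0 ((f 1 * f 1 - f 0 * f 0 + f 2 - f 0 * f 1 * (f 0 * f 1) * f 4) * (1 + f 7 * f 7 + f 8 * f 8) * dd 1 (f 6))) := hE 7
    have e8 : f 8 = 0 + (JJ 0 (-(f 0 * f 1 * f 4) * dd 1 (f 8))
      - JJ 0 ((f 1 * f 1 - f 0 * f 0 + f 2 - f 0 * f 1 * (f 0 * f 1) * f 4) * (1 + f 7 * f 7 + f 8 * f 8) * dd 1 (f 5))) := hE 8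
    have e9 : f 9 = 1 + -((f 7 * (X 1 + JJ 0 (-(f 0 * f 1 * f 4) * dd 1 (f 7))
      + JJ 0 ((f 1 * f 1 - f 0 * f 0 + f 2 - f 0 * f 1 * (f 0 * f 1) * f 4) * (1 + f 7 * f 7 + f 8 * f 8) * dd 1 (f 6)))
      + f 8 * (JJ 0 (-(f 0 * f 1 * f 4) * dd 1 (f 8))
      - JJ 0 ((f 1 * f 1 - f 0 * f 0 + f 2 - f 0 * f 1 * (f 0 * f 1) * f 4) * (1 + f 7 * f 7 + f 8 * f 8) * dd 1 (f 5)))) * f 9) := hE 9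
    clear hE hf
    rw [zero_add] at e3 e5 e6 e7 e8
    rw [← e7, ← e8] at e9
    generalize f 0 = u at *
    generalize f 1 = v at *
    generalize f 2 = N at *
    generalize f 3 = Z at *
    generalize f 4 = q at *
    generalize f 5 = x at *
    generalize f 6 = y at *
    generalize f 7 = P at *
    generalize f 8 = Q at *
    generalize f 9 = W at *
    have hW : W * (1 + P * P + Q * Q) = 1 := by linear_combination e9
    have hq : q * N = 1 := by linear_combination e4 + q * e2
    have dN : dd 0 N = dd 1 (Z - (u * v + u * v)) := by
      rw [e2, dd_add, dd_one, dd_JJ, zero_add]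
    have dZ : dd 0 Z = dd 1 (u * u - v * v - N) := by
      conv_lhs => rw [e3]
      rw [dd_JJ]
    have dX0 : dd 0 (X 1) = 0 := by simp [dd]
    have dX1 : dd 1 (X 1) = 1 := by simp [dd]
    have dx : dd 0 x = -(u * v * q) * dd 1 x + q * W * dd 1 Q := by
      conv_lhs => rw [e5]
      rw [dd_add, dd_add, dd_JJ, dd_JJ, dX0, zero_add]
    have dy : dd 0 y = -(u * v * q) * dd 1 y - q * W * dd 1 P := by
      conv_lhs => rw [e6]
      rw [dd_sub, dd_JJ, dd_JJ]
    have dP : dd 0 P = -(u * v * q) * dd 1 P + 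
        (v * v - u * u + N - u * v * (u * v) * q) * (1 + P * P + Q * Q) * dd 1 y := by
      conv_lhs => rw [e7]
      rw [dd_add, dd_add, dd_JJ, dd_JJ, dX0, zero_add]
    have dQ : dd 0 Q = -(u * v * q) * dd 1 Q - 
        (v * v - u * u + N - u * v * (u * v) * q) * (1 + P * P + Q * Q) * dd 1 x := by
      conv_lhs => rw [e8]
      rw [dd_sub, dd_JJ, dd_JJ]
    have n10 : (1 : Fin 3) ≠ 0 := by decide
    have n02 : (0 : Fin 3) ≠ 2 := by decide
    have n12 : (1 : Fin 3) ≠ 2 := by decide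
    refine ⟨?_, ?_, ?_, ?_, ?_, ?_, ?_, ?_, ?_, hW, ?_⟩
    · intro m hm
      rw [e0, map_add, map_neg, coeff_JJ_zero _ _ _ hm]; simp
    · intro m hm
      rw [e1, map_add, map_sub, map_neg, coeff_JJ_zero _ _ _ hm, coeff_JJ_zero _ _ _ hm]; simp
    · conv_lhs => rw [e0]
      rw [dd_add, dd_neg, dd_JJ, dN, hU2]
      simp only [dd_sub, dd_add]; ring
    · conv_lhs => rw [e1]
      rw [dd_add, dd_sub, dd_neg, dd_JJ, dd_JJ, hV2]
      ring
    · have du : dd 0 u = dd 0 U0 - JJ 2 (dd 0 (dd 1 (Z - u * v))) := by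
        conv_lhs => rw [e0]
        rw [dd_add, dd_neg, dd_JJ_ne _ _ n02]; ring
      have dv : dd 1 v = dd 1 V0 - JJ 2 (dd 1 (dd 0 (u * v))) - JJ 2 (dd 1 (dd 1 (v * v - u * u + N))) := by
        conv_lhs => rw [e1]
        rw [dd_add, dd_sub, dd_neg, dd_JJ_ne _ _ n12, dd_JJ_ne _ _ n12]; ring
      have h3 : dd 0 (dd 1 (Z - u * v)) + dd 1 (dd 0 (u * v)) + dd 1 (dd 1 (v * v - u * u + N)) = 0 := by
        rw [dd_comm 0 1, dd_sub, dZ, ← dd_add, ← dd_add]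
        have : dd 1 (u * u - v * v - N) - dd 0 (u * v) + dd 0 (u * v) + dd 1 (v * v - u * u + N) = 0 := by
          simp only [dd_sub, dd_add]; ring
        rw [this, dd_zero]
      have h4 := congrArg (JJ 2) h3
      rw [JJ_add, JJ_add, JJ_z] at h4
      linear_combination du + dv - h4 + hd
    · linear_combination N * dx + (W * dd 1 Q - u * v * dd 1 x) * hq
    · linear_combination N * dy + (- W * dd 1 P - u * v * dd 1 y) * hq
    · linear_combination dP - (1 + P * P + Q * Q) * u * v * dy + u * v * q * dd 1 P * hW
    · linear_combination dQ + (1 + P * P + Q * Q) * u * v * dx + u * v * q * dd 1 Q * hW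
    · have cx : constantCoeff (dd 1 x) = 1 := by
        rw [e5, dd_add, dd_add, dX1, dd_JJ_ne _ _ n10, dd_JJ_ne _ _ n10]
        simp [cst_JJ]
      have cy : constantCoeff (dd 1 y) = 0 := by
        rw [e6, dd_sub, dd_JJ_ne _ _ n10, dd_JJ_ne _ _ n10]
        simp [cst_JJ]
      have cP : constantCoeff (dd 1 P) = 1 := by
        rw [e7, dd_add, dd_add, dX1, dd_JJ_ne _ _ n10, dd_JJ_ne _ _ n10]
        simp [cst_JJ]
      have cN : constantCoeff N = 1 := by rw [e2]; simp [cst_JJ]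
      have cp : constantCoeff P = 0 := by rw [e7]; simp [cst_JJ]
      have cQ : constantCoeff Q = 0 := by rw [e8]; simp [cst_JJ]
      have cq : constantCoeff q = 1 := by
        have := congrArg constantCoeff hq
        simpa [cN] using this
      have cW : constantCoeff W = 1 := by
        have := congrArg constantCoeff hW
        simpa [cp, cQ] using this
      rw [dy]
      simp [cx, cy, cP, cW, cq]

end CK

namespace CK
open MvPowerSeries Finsupp

noncomputable def mon (q : Fin 3 → ℝ) (m : Fin 3 →₀ ℕ) : ℝ := ∏ i, q i ^ m i

lemma mon_add (q : Fin 3 → ℝ) (m n : Fin 3 →₀ ℕ) : mon q (m + n) = mon q m * mon q n := by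
  simp [mon, pow_add, Finset.prod_mul_distrib]

lemma mon_zero (q : Fin 3 → ℝ) : mon q 0 = 1 := by simp [mon]

lemma mon_single (q : Fin 3 → ℝ) (i : Fin 3) : mon q (single i 1) = q i := by
  classical
  rw [mon, Finset.prod_eq_single i]
  · simp
  · intro j _ hj; simp [Finsupp.single_apply, hj.symm]
  · simp

lemma mon_le (q : Fin 3 → ℝ) (s : ℝ) (h : ∀ i, |q i| ≤ s) (m : Fin 3 →₀ ℕ) : |mon q m| ≤ s ^ m.degree := by
  rw [mon, Finset.abs_prod, Finsupp.degree_eq_sum, ← Finset.prod_pow_eq_pow_sum]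
  refine Finset.prod_le_prod (fun i _ => abs_nonneg _) fun i _ => ?_
  rw [abs_pow]
  exact pow_le_pow_left₀ (abs_nonneg _) (h i) _

/-- absolute convergence on the box of radius `r`. -/
def Cv (r : ℝ) (f : PS) : Prop :=
  ∀ s, 0 ≤ s → s < r → Summable (fun m => |coeff m f| * s ^ m.degree)

def bx (r : ℝ) : Set (Fin 3 → ℝ) := {q | ∀ i, |q i| < r}

noncomputable def Ev (f : PS) (q : Fin 3 → ℝ) : ℝ := ∑' m, coeff m f * mon q m

lemma summable_theta (θ : ℝ) (h0 : 0 ≤ θ) (h1 : θ < 1) : Summable (fun m : Fin 3 →₀ ℕ => θ ^ m.degree) := by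
  have g := summable_geometric_of_lt_one h0 h1
  have g2 := g.mul_of_nonneg g (fun n => by positivity) (fun n => by positivity)
  have g3 := g.mul_of_nonneg g2 (fun n => by positivity) (fun n => by
    show 0 ≤ θ ^ n.1 * θ ^ n.2
    positivity)
  have hi : Function.Injective (fun m : Fin 3 →₀ ℕ => ((m 0, m 1, m 2) : ℕ × ℕ × ℕ)) := by
    intro m n h
    simp only [Prod.mk.injEq] at h
    ext i
    fin_cases i
    · exact h.1
    · exact h.2.1
    · exact h.2.2
  refine (g3.comp_injective hi).congr fun m => ?_
  rw [Finsupp.degree_eq_sum, Fin.sum_univ_three]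
  simp only [Function.comp]
  ring

lemma bx_exists {r : ℝ} {q : Fin 3 → ℝ} (hq : q ∈ bx r) : ∃ s, 0 ≤ s ∧ s < r ∧ ∀ i, |q i| ≤ s := by
  refine ⟨max |q 0| (max |q 1| |q 2|), le_max_of_le_left (abs_nonneg _), ?_, ?_⟩
  · simp [hq 0, hq 1, hq 2]
  · intro i
    fin_cases i
    · exact le_max_left _ _
    · exact le_max_of_le_right (le_max_left _ _)
    · exact le_max_of_le_right (le_max_right _ _)

lemma Cv.summable {r : ℝ} {f : PS} (h : Cv r f) {q : Fin 3 → ℝ} (hq : q ∈ bx r) :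
    Summable (fun m => |coeff m f * mon q m|) := by
  obtain ⟨s, h0, h1, h2⟩ := bx_exists hq
  refine Summable.of_nonneg_of_le (fun m => abs_nonneg _) (fun m => ?_) (h s h0 h1)
  rw [abs_mul]
  exact mul_le_mul_of_nonneg_left (mon_le q s h2 m) (abs_nonneg _)

lemma Cv.add {r : ℝ} {f g : PS} (hf : Cv r f) (hg : Cv r g) : Cv r (f + g) := by
  intro s h0 h1
  refine Summable.of_nonneg_of_le (fun m => by positivity) (fun m => ?_) ((hf s h0 h1).add (hg s h0 h1))
  rw [map_add, ← add_mul]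
  exact mul_le_mul_of_nonneg_right (abs_add_le _ _) (by positivity)

lemma Cv.neg {r : ℝ} {f : PS} (hf : Cv r f) : Cv r (-f) := by
  intro s h0 h1
  simpa using hf s h0 h1

lemma Cv.zero {r : ℝ} : Cv r 0 := by
  intro s h0 h1
  simpa using summable_zero

lemma Cv.one {r : ℝ} : Cv r 1 := by
  classical
  intro s h0 h1
  refine summable_of_ne_finset_zero (s := {0}) fun m hm => ?_
  rw [coeff_one, if_neg (by simpa using hm)]
  simp

lemma antidiag_summable {A : Type*} [AddCommMonoid A] [Finset.HasAntidiagonal A] {f g : A → ℝ}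
    (hf : Summable (fun m => |f m|)) (hg : Summable (fun m => |g m|)) :
    Summable (fun m => ∑ p ∈ Finset.HasAntidiagonal.antidiagonal m, f p.1 * g p.2) :=
  summable_sum_mul_antidiagonal_of_summable_mul (summable_mul_of_summable_norm hf hg)

lemma antidiag_tsum {A : Type*} [AddCommMonoid A] [Finset.HasAntidiagonal A] {f g : A → ℝ}
    (hf : Summable (fun m => |f m|)) (hg : Summable (fun m => |g m|)) :
    ((∑' m, f m) * ∑' m, g m) = ∑' m, ∑ p ∈ Finset.HasAntidiagonal.antidiagonal m, f p.1 * g p.2 :=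
  Summable.tsum_mul_tsum_eq_tsum_sum_antidiagonal hf.of_abs hg.of_abs (summable_mul_of_summable_norm hf hg)

lemma Cv.mul {r : ℝ} {f g : PS} (hf : Cv r f) (hg : Cv r g) : Cv r (f * g) := by
  intro s h0 h1
  have h2 : Summable (fun m : Fin 3 →₀ ℕ => ∑ p ∈ Finset.HasAntidiagonal.antidiagonal m,
      (|coeff p.1 f| * s ^ p.1.degree) * (|coeff p.2 g| * s ^ p.2.degree)) :=
    antidiag_summable (f := fun m => |coeff m f| * s ^ m.degree) (g := fun m => |coeff m g| * s ^ m.degree)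
      (hf s h0 h1).abs (hg s h0 h1).abs
  refine Summable.of_nonneg_of_le (fun m => by positivity) (fun m => ?_) h2
  rw [coeff_mul]
  refine (mul_le_mul_of_nonneg_right (Finset.abs_sum_le_sum_abs _ _) (by positivity)).trans (le_of_eq ?_)
  rw [Finset.sum_mul]
  refine Finset.sum_congr rfl fun p hp => ?_
  rw [← Finset.HasAntidiagonal.mem_antidiagonal.1 hp, map_add, pow_add, abs_mul]
  ring

lemma Ev_add {r : ℝ} {f g : PS} (hf : Cv r f) (hg : Cv r g) {q : Fin 3 → ℝ} (hq : q ∈ bx r) :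
    Ev (f + g) q = Ev f q + Ev g q := by
  rw [Ev, Ev, Ev, ← (hf.summable hq).of_abs.tsum_add (hg.summable hq).of_abs]
  simp [add_mul]

lemma Ev_zero (q : Fin 3 → ℝ) : Ev 0 q = 0 := by simp [Ev]

lemma Ev_one (q : Fin 3 → ℝ) : Ev 1 q = 1 := by
  classical
  rw [Ev, tsum_eq_single 0]
  · simp [mon_zero]
  · intro m hm; rw [coeff_one, if_neg hm, zero_mul]

lemma Ev_mul {r : ℝ} {f g : PS} (hf : Cv r f) (hg : Cv r g) {q : Fin 3 → ℝ} (hq : q ∈ bx r) :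
    Ev (f * g) q = Ev f q * Ev g q := by
  have h1 := (hf.summable hq)
  have h2 := (hg.summable hq)
  rw [Ev, Ev, Ev, antidiag_tsum h1 h2]
  refine tsum_congr fun m => ?_
  rw [coeff_mul, Finset.sum_mul]
  refine Finset.sum_congr rfl fun p hp => ?_
  rw [← Finset.HasAntidiagonal.mem_antidiagonal.1 hp, mon_add]
  ring

lemma Ev_origin (f : PS) : Ev f 0 = constantCoeff f := by
  rw [Ev, tsum_eq_single 0]
  · simp [mon_zero]
  · intro m hm
    obtain ⟨i, hi⟩ : ∃ i, m i ≠ 0 := by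
      by_contra! h
      exact hm (Finsupp.ext h)
    rw [mon, Finset.prod_eq_zero (Finset.mem_univ i) (by simp [hi]), mul_zero]

lemma Bd.cv {a : Fin 3 → ℝ} (ha : ∀ i, 0 < a i) {f : PS} {ρ : ℝ} (h : Bd a f ρ) : Cv (1 / ∑ i, a i) f := by
  intro s h0 h1
  have hA : 0 < ∑ i, a i := Finset.sum_pos (fun i _ => ha i) Finset.univ_nonempty
  have hθ : (∑ i, a i) * s < 1 := by
    rw [lt_div_iff₀ hA] at h1; linarith
  refine Summable.of_nonneg_of_le (fun m => by positivity) (fun m => ?_)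
    ((summable_theta _ (by positivity) hθ).mul_left ρ)
  have hρ := h.nonneg ha
  refine (mul_le_mul_of_nonneg_right (h m) (by positivity)).trans ?_
  rw [mul_pow, mul_assoc]
  refine mul_le_mul_of_nonneg_left (mul_le_mul_of_nonneg_right ?_ (by positivity)) hρ
  have h3 := cc_upper a ha m
  have h4 : bb m.degree ≤ 1 := by
    rw [bb, div_le_one (by positivity)]
    have : (0 : ℝ) ≤ m.degree := by positivity
    nlinarith
  have := cc_pos a ha m
  unfold wt
  nlinarith

lemma Cv.mono {r r' : ℝ} {f : PS} (h : Cv r f) (hr : r' ≤ r) : Cv r' f :=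
  fun s h0 h1 => h s h0 (h1.trans_le hr)

/-- auxiliary: `n s^n` bound -/
lemma exists_bound (s s' : ℝ) (h0 : 0 ≤ s) (h1 : s < s') :
    ∃ C, 0 ≤ C ∧ ∀ n : ℕ, ((n : ℝ) + 1) * s ^ n ≤ C * s' ^ (n + 1) := by
  have hs' : 0 < s' := h0.trans_lt h1
  have hn : ‖s / s'‖ < 1 := by
    rw [Real.norm_of_nonneg (by positivity), div_lt_one hs']; exact h1
  have hsum : Summable (fun n : ℕ => ((n : ℝ) + 1) * (s / s') ^ n) := by
    have e1 := summable_pow_mul_geometric_of_norm_lt_one 1 hn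
    have e2 := summable_geometric_of_norm_lt_one hn
    refine (e1.add e2).congr fun n => ?_
    ring
  have hnn : ∀ n : ℕ, 0 ≤ ((n : ℝ) + 1) * (s / s') ^ n := fun n => by positivity
  refine ⟨(∑' n : ℕ, ((n : ℝ) + 1) * (s / s') ^ n) / s', div_nonneg (tsum_nonneg hnn) hs'.le, fun n => ?_⟩
  have := hsum.le_tsum n (fun j _ => hnn j)
  rw [div_pow, ← mul_div_assoc, div_le_iff₀ (by positivity)] at this
  rw [pow_succ]
  field_simp
  exact this

lemma degree_succ (m : Fin 3 →₀ ℕ) (i : Fin 3) : (m + single i 1).degree = m.degree + 1 := by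
  rw [map_add]; simp

lemma inj_add (i : Fin 3) : Function.Injective (fun m : Fin 3 →₀ ℕ => m + single i 1) :=
  add_left_injective _

lemma Cv.dd {r : ℝ} {f : PS} (hf : Cv r f) (i : Fin 3) : Cv r (dd i f) := by
  intro s h0 h1
  obtain ⟨s', hs, hs'⟩ := exists_between h1
  obtain ⟨C, hC, hb⟩ := exists_bound s s' h0 hs
  have h2 := ((hf s' (h0.trans hs.le) hs').comp_injective (inj_add i)).mul_left C
  refine Summable.of_nonneg_of_le (fun m => by positivity) (fun m => ?_) h2
  simp only [Function.comp]
  rw [degree_succ, coeff_dd, abs_mul]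
  have h3 : (m i : ℝ) ≤ m.degree := by exact_mod_cast le_degree' m i
  have h4 : |(m i : ℝ) + 1| = m i + 1 := abs_of_nonneg (by positivity)
  rw [h4]
  calc _ ≤ |coeff (m + single i 1) f| * ((m.degree + 1) * s ^ m.degree) := by
        rw [mul_assoc]
        gcongr
    _ ≤ |coeff (m + single i 1) f| * (C * s' ^ (m.degree + 1)) := by
        exact mul_le_mul_of_nonneg_left (hb _) (abs_nonneg _)
    _ = _ := by ring

lemma mon_update (q : Fin 3 → ℝ) (i : Fin 3) (s : ℝ) (m : Fin 3 →₀ ℕ) :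
    mon (Function.update q i s) m = s ^ m i * ∏ j ∈ Finset.univ.erase i, q j ^ m j := by
  rw [mon, ← Finset.mul_prod_erase _ _ (Finset.mem_univ i)]
  congr 1
  · simp
  · refine Finset.prod_congr rfl fun j hj => ?_
    rw [Function.update_of_ne (Finset.ne_of_mem_erase hj)]

lemma hasDeriv_Ev {r : ℝ} {f : PS} (hf : Cv r f) {q : Fin 3 → ℝ} (hq : q ∈ bx r) (i : Fin 3) :
    HasDerivAt (fun s => Ev f (Function.update q i s)) (Ev (CK.dd i f) q) (q i) := by
  obtain ⟨s, h0, h1, h2⟩ := bx_exists hq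
  obtain ⟨s1, hs, hs1⟩ := exists_between h1
  obtain ⟨s2, hss, hs2⟩ := exists_between hs1
  obtain ⟨C, hC, hb⟩ := exists_bound s1 s2 (h0.trans hs.le) hss
  have key := hasDerivAt_tsum_of_isPreconnected (𝕜 := ℝ) (F := ℝ)
    (g := fun m z => coeff m f * mon (Function.update q i z) m)
    (g' := fun m z => coeff m f * ((m i : ℝ) * z ^ (m i - 1) * ∏ j ∈ Finset.univ.erase i, q j ^ m j))
    (u := fun m => C * (|coeff m f| * s2 ^ m.degree)) (t := Set.Ioo (-s1) s1)
    (y₀ := q i) (y := q i)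
    ((hf s2 (h0.trans (hs.le.trans hss.le)) hs2).mul_left C) isOpen_Ioo isPreconnected_Ioo
    ?_ ?_ ?_ ?_ ?_
  · have hinj := inj_add i
    suffices hv : Ev (CK.dd i f) q = ∑' m : Fin 3 →₀ ℕ, coeff m f *
        ((m i : ℝ) * q i ^ (m i - 1) * ∏ j ∈ Finset.univ.erase i, q j ^ m j) by
      rw [hv]; exact key
    rw [Ev, ← hinj.tsum_eq (f := fun m : Fin 3 →₀ ℕ => coeff m f *
        ((m i : ℝ) * q i ^ (m i - 1) * ∏ j ∈ Finset.univ.erase i, q j ^ m j))]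
    · refine tsum_congr fun m => ?_
      have := mon_update q i (q i) m
      rw [Function.update_eq_self] at this
      rw [coeff_dd, this]
      have h5 : (m + single i 1 : Fin 3 →₀ ℕ) i = m i + 1 := by simp
      rw [h5]
      have h6 : ∏ j ∈ Finset.univ.erase i, q j ^ (m + single i 1 : Fin 3 →₀ ℕ) j = ∏ j ∈ Finset.univ.erase i, q j ^ m j :=
        Finset.prod_congr rfl fun j hj => by
          simp [Finsupp.single_apply, (Finset.ne_of_mem_erase hj).symm]
      rw [h6]
      push_cast
      ring
    · intro m hm
      by_cases h : m i = 0
      · simp [h] at hm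
      · obtain ⟨n, hn⟩ := exists_pred i m h
        exact ⟨n, hn.symm⟩
  · intro m z _
    simp only [mon_update]
    exact ((hasDerivAt_pow (m i) z).mul_const _).const_mul _
  · intro m z hz
    by_cases h : m i = 0
    · simp only [h]
      have : 0 < s2 := (h0.trans_lt hs).trans hss
      simp
      positivity
    · obtain ⟨n, rfl⟩ := exists_pred i m h
      have hz' : |z| ≤ s1 := abs_le.2 ⟨hz.1.le, hz.2.le⟩
      have h5 : (n + single i 1 : Fin 3 →₀ ℕ) i = n i + 1 := by simp
      have h6 : ∏ j ∈ Finset.univ.erase i, q j ^ (n + single i 1 : Fin 3 →₀ ℕ) j = ∏ j ∈ Finset.univ.erase i, q j ^ n j :=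
        Finset.prod_congr rfl fun j hj => by
          simp [Finsupp.single_apply, (Finset.ne_of_mem_erase hj).symm]
      rw [h5, h6, Nat.add_sub_cancel, mul_assoc, ← mon_update, norm_mul, norm_mul, degree_succ]
      have h7 : |mon (Function.update q i z) n| ≤ s1 ^ n.degree := by
        refine mon_le _ _ (fun j => ?_) _
        by_cases hj : j = i
        · subst hj; simpa using hz'
        · rw [Function.update_of_ne hj]; exact (h2 j).trans hs.le
      have h3 : (n i : ℝ) ≤ n.degree := by exact_mod_cast le_degree' n i
      have h8 : ‖((n i + 1 : ℕ) : ℝ)‖ = n i + 1 := by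
        rw [Real.norm_of_nonneg (by positivity)]; push_cast; rfl
      rw [h8, Real.norm_eq_abs, Real.norm_eq_abs]
      have h9 : 0 ≤ s1 := h0.trans hs.le
      calc _ ≤ |coeff (n + single i 1) f| * ((n.degree + 1) * s1 ^ n.degree) := by
            gcongr
        _ ≤ |coeff (n + single i 1) f| * (C * s2 ^ (n.degree + 1)) := by
            exact mul_le_mul_of_nonneg_left (hb _) (abs_nonneg _)
        _ = _ := by ring
  · exact ⟨by linarith [(abs_le.1 (h2 i)).1], by linarith [(abs_le.1 (h2 i)).2]⟩
  · rw [Function.update_eq_self]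
    exact (hf.summable hq).of_abs
  · exact ⟨by linarith [(abs_le.1 (h2 i)).1], by linarith [(abs_le.1 (h2 i)).2]⟩

end CK

namespace CK
open MvPowerSeries Finsupp

lemma exists_multilin (m : Fin 3 →₀ ℕ) : ∀ n : ℕ, m.degree = n →
    ∃ M : ContinuousMultilinearMap ℝ (fun _ : Fin n => Fin 3 → ℝ) ℝ, ‖M‖ ≤ 1 ∧ ∀ x, M (fun _ => x) = mon x m := by
  induction m using ind_succ with
  | h0 =>
    intro n hn
    have : n = 0 := by simpa using hn.symm
    subst this
    refine ⟨ContinuousMultilinearMap.constOfIsEmpty ℝ _ 1, ?_, fun x => ?_⟩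
    · simp
    · simp [mon_zero]
  | hs m i ih =>
    intro n hn
    rw [degree_succ] at hn
    subst hn
    obtain ⟨M, hM, hMx⟩ := ih _ rfl
    refine ⟨((ContinuousLinearMap.proj (R := ℝ) (φ := fun _ : Fin 3 => ℝ) i).smulRight M).uncurryLeft, ?_, fun x => ?_⟩
    · rw [ContinuousLinearMap.uncurryLeft_norm, ContinuousLinearMap.norm_smulRight_apply]
      have : ‖(ContinuousLinearMap.proj (R := ℝ) (φ := fun _ : Fin 3 => ℝ) i)‖ ≤ 1 :=
        ContinuousLinearMap.opNorm_le_bound _ zero_le_one fun x => by simpa using norm_le_pi_norm x i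
      exact mul_le_one₀ this (norm_nonneg _) hM
    · rw [ContinuousLinearMap.uncurryLeft_apply]
      have : (Fin.tail fun _ : Fin (m.degree + 1) => x) = fun _ => x := rfl
      simp only [ContinuousLinearMap.smulRight_apply, _root_.smul_apply]
      rw [mon_add, mon_single, mul_comm]
      erw [hMx]
      simp

noncomputable def ml (m : Fin 3 →₀ ℕ) (n : ℕ) : ContinuousMultilinearMap ℝ (fun _ : Fin n => Fin 3 → ℝ) ℝ :=
  if h : m.degree = n then (exists_multilin m n h).choose else 0

lemma ml_norm (m : Fin 3 →₀ ℕ) (n : ℕ) : ‖ml m n‖ ≤ 1 := by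
  unfold ml
  split_ifs with h
  · exact (exists_multilin m n h).choose_spec.1
  · simp

lemma ml_apply (m : Fin 3 →₀ ℕ) (n : ℕ) (h : m.degree = n) (x : Fin 3 → ℝ) : ml m n (fun _ => x) = mon x m := by
  unfold ml
  rw [dif_pos h]
  exact (exists_multilin m n h).choose_spec.2 x

lemma mem_deg (m : Fin 3 →₀ ℕ) (n : ℕ) : m ∈ (Finset.univ : Finset (Fin 3)).finsuppAntidiag n ↔ m.degree = n := by
  rw [Finset.mem_finsuppAntidiag, Finsupp.degree_eq_sum]
  simp

lemma hasSum_degree {r : ℝ} {f : PS} (hf : Cv r f) {y : Fin 3 → ℝ} (hy : y ∈ bx r) :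
    HasSum (fun n => ∑ m ∈ (Finset.univ : Finset (Fin 3)).finsuppAntidiag n, coeff m f * mon y m) (Ev f y) := by
  have h1 := (hf.summable hy).of_abs.hasSum.tsum_fiberwise (fun m => m.degree)
  have h2 : (fun n => ∑ m ∈ (Finset.univ : Finset (Fin 3)).finsuppAntidiag n, coeff m f * mon y m) =
      fun c => ∑' (b : ((fun m : Fin 3 →₀ ℕ => m.degree) ⁻¹' {c})), coeff b.1 f * mon y b.1 := by
    funext n
    have hset : ((fun m : Fin 3 →₀ ℕ => m.degree) ⁻¹' {n}) =
        (((Finset.univ : Finset (Fin 3)).finsuppAntidiag n : Finset (Fin 3 →₀ ℕ)) : Set (Fin 3 →₀ ℕ)) := by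
      ext m
      rw [Finset.mem_coe, mem_deg]; rfl
    rw [hset, Finset.tsum_subtype' _ (fun m => coeff m f * mon y m)]
  rw [h2]
  exact h1

noncomputable def fps (f : PS) : FormalMultilinearSeries ℝ (Fin 3 → ℝ) ℝ := fun n =>
  ∑ m ∈ (Finset.univ : Finset (Fin 3)).finsuppAntidiag n, coeff m f • ml m n

lemma analytic_Ev {r : ℝ} (hr : 0 < r) {f : PS} (hf : Cv r f) : AnalyticOnNhd ℝ (Ev f) (bx r) := by
  have hfp : HasFPowerSeriesOnBall (Ev f) (fps f) 0 (ENNReal.ofReal r) := by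
    refine ⟨?_, by simpa using hr, ?_⟩
    · refine ENNReal.le_of_forall_nnreal_lt fun s hs => ?_
      have hs' : (s : ℝ) < r := by
        rw [← ENNReal.ofReal_coe_nnreal] at hs
        exact (ENNReal.ofReal_lt_ofReal_iff hr).1 hs
      have hsum := hf s s.2 hs'
      refine (fps f).le_radius_of_bound (∑' m, |coeff m f| * (s : ℝ) ^ m.degree) fun n => ?_
      refine le_trans ?_ (hsum.sum_le_tsum ((Finset.univ : Finset (Fin 3)).finsuppAntidiag n) fun m _ => by positivity)
      rw [← Finset.sum_congr rfl (g := fun m => |coeff m f| * (s : ℝ) ^ m.degree)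
        (f := fun m => |coeff m f| * (s : ℝ) ^ n) (fun m hm => by rw [(mem_deg m n).1 hm]), ← Finset.sum_mul]
      refine mul_le_mul_of_nonneg_right ?_ (by positivity)
      refine (norm_sum_le _ _).trans (Finset.sum_le_sum fun m _ => ?_)
      rw [norm_smul]
      exact mul_le_of_le_one_right (norm_nonneg _) (ml_norm _ _)
    · intro y hy
      have hyb : y ∈ bx r := by
        rw [Metric.eball_ofReal, Metric.mem_ball, dist_zero_right] at hy
        intro i
        exact (norm_le_pi_norm y i).trans_lt hy
      rw [zero_add]
      have h1 := hasSum_degree hf hyb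
      have h2 : (fun n => fps f n fun _ => y) = fun n =>
          ∑ m ∈ (Finset.univ : Finset (Fin 3)).finsuppAntidiag n, coeff m f * mon y m := by
        funext n
        rw [fps, _root_.sum_apply]
        refine Finset.sum_congr rfl fun m hm => ?_
        rw [_root_.smul_apply, ml_apply m n ((mem_deg m n).1 hm), smul_eq_mul]
      rw [h2]
      exact h1
  have := hfp.analyticOnNhd
  refine this.mono fun q hq => ?_
  rw [Metric.eball_ofReal, Metric.mem_ball, dist_zero_right, pi_norm_lt_iff hr]
  exact hq

end CK

namespace CK
open MvPowerSeries Finsupp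

lemma Ev_inj {r : ℝ} (hr : 0 < r) (m : Fin 3 →₀ ℕ) : ∀ f : PS, Cv r f → (∀ q ∈ bx r, Ev f q = 0) → coeff m f = 0 := by
  induction m using ind_succ with
  | h0 =>
    intro f hf h
    have := h 0 (fun i => by simpa using hr)
    rw [Ev_origin] at this
    simpa using this
  | hs m i ih =>
    intro f hf h
    have h1 := ih (dd i f) (hf.dd i) (fun q hq => by
      have h2 := hasDeriv_Ev hf hq i
      have h3 : (fun s => Ev f (Function.update q i s)) =ᶠ[nhds (q i)] fun _ => 0 := by
        have : Set.Ioo (-r) r ∈ nhds (q i) := Ioo_mem_nhds (abs_lt.1 (hq i)).1 (abs_lt.1 (hq i)).2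
        filter_upwards [this] with s hs
        refine h _ fun j => ?_
        by_cases hj : j = i
        · subst hj; simpa using abs_lt.2 hs
        · rw [Function.update_of_ne hj]; exact hq j
      have h4 := h2.congr_of_eventuallyEq h3.symm
      exact h4.unique (hasDerivAt_const _ _))
    rw [coeff_dd] at h1
    have : (m i : ℝ) + 1 ≠ 0 := by positivity
    exact (mul_eq_zero.1 h1).resolve_right this

noncomputable def cnt {n : ℕ} (w : Fin n → Fin 3) : Fin 3 →₀ ℕ := ∑ k, single (w k) 1

lemma cnt_degree {n : ℕ} (w : Fin n → Fin 3) : (cnt w).degree = n := by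
  simp [cnt, map_sum]

lemma mon_cnt {n : ℕ} (w : Fin n → Fin 3) (y : Fin 3 → ℝ) : mon y (cnt w) = ∏ k, y (w k) := by
  unfold cnt
  induction (Finset.univ : Finset (Fin n)) using Finset.induction_on with
  | empty => simp [mon_zero]
  | insert a s ha ih => rw [Finset.sum_insert ha, Finset.prod_insert ha, mon_add, mon_single, ih]

noncomputable def ee (i : Fin 3) : Fin 3 → ℝ := Pi.single i 1

lemma ee_norm (i : Fin 3) : ‖ee i‖ ≤ 1 := by
  rw [pi_norm_le_iff_of_nonneg zero_le_one]
  intro j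
  unfold ee
  by_cases h : j = i
  · subst h; simp
  · rw [Pi.single_eq_of_ne h]; simp

open Classical in
noncomputable def cf (p : FormalMultilinearSeries ℝ (Fin 3 → ℝ) ℝ) : PS := fun m =>
  ∑ w : Fin m.degree → Fin 3, if cnt w = m then p m.degree (fun k => ee (w k)) else 0

open Classical in
lemma coeff_cf (p : FormalMultilinearSeries ℝ (Fin 3 → ℝ) ℝ) (m : Fin 3 →₀ ℕ) (n : ℕ) (h : m.degree = n) :
    coeff m (cf p) = ∑ w : Fin n → Fin 3, if cnt w = m then p n (fun k => ee (w k)) else 0 := by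
  subst h; rfl

lemma cf_bound (p : FormalMultilinearSeries ℝ (Fin 3 → ℝ) ℝ) (m : Fin 3 →₀ ℕ) :
    |coeff m (cf p)| ≤ 3 ^ m.degree * ‖p m.degree‖ := by
  classical
  rw [coeff_cf p m _ rfl]
  refine (Finset.abs_sum_le_sum_abs _ _).trans ?_
  refine (Finset.sum_le_card_nsmul _ _ ‖p m.degree‖ fun w _ => ?_).trans (le_of_eq ?_)
  · split_ifs
    · refine ((p m.degree).le_opNorm _).trans ?_
      refine mul_le_of_le_one_right (norm_nonneg _) ?_
      exact Finset.prod_le_one (fun _ _ => norm_nonneg _) (fun k _ => ee_norm _)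
    · simp
  · simp

lemma p_expand (p : FormalMultilinearSeries ℝ (Fin 3 → ℝ) ℝ) (n : ℕ) (y : Fin 3 → ℝ) :
    p n (fun _ => y) = ∑ m ∈ (Finset.univ : Finset (Fin 3)).finsuppAntidiag n, coeff m (cf p) * mon y m := by
  classical
  have hy : y = ∑ i, y i • ee i := by
    funext j
    simp [ee, Finset.sum_apply, Pi.single_apply]
  conv_lhs => rw [hy]
  have h1 := (p n).toMultilinearMap.map_sum (fun (_ : Fin n) (i : Fin 3) => y i • ee i)
  have h2 : (p n) (fun _ => ∑ i, y i • ee i) = ∑ w : Fin n → Fin 3, (p n) (fun k => y (w k) • ee (w k)) := h1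
  rw [h2]
  have h3 : ∀ w : Fin n → Fin 3, (p n) (fun k => y (w k) • ee (w k)) = mon y (cnt w) * p n (fun k => ee (w k)) := by
    intro w
    rw [(p n).map_smul_univ, mon_cnt, smul_eq_mul]
  simp_rw [h3]
  have h4 : ∑ m ∈ (Finset.univ : Finset (Fin 3)).finsuppAntidiag n, coeff m (cf p) * mon y m =
      ∑ m ∈ (Finset.univ : Finset (Fin 3)).finsuppAntidiag n, ∑ w : Fin n → Fin 3,
        (if cnt w = m then p n (fun k => ee (w k)) else 0) * mon y m :=
    Finset.sum_congr rfl (fun m hm => by rw [coeff_cf p m n ((mem_deg m n).1 hm), Finset.sum_mul])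
  rw [h4, Finset.sum_comm]
  refine Finset.sum_congr rfl fun w _ => ?_
  rw [Finset.sum_eq_single (cnt w)]
  · rw [if_pos rfl]; ring
  · intro m _ hm; rw [if_neg hm.symm, zero_mul]
  · intro h; exact absurd ((mem_deg _ _).2 (cnt_degree w)) h

lemma Cv_of_bound {f : PS} {A B : ℝ} (hB : 0 < B) (h : ∀ m, |coeff m f| ≤ A * B ^ m.degree) : Cv (1 / B) f := by
  intro s h0 h1
  have hθ : B * s < 1 := by
    rw [lt_div_iff₀ hB] at h1; linarith
  refine Summable.of_nonneg_of_le (fun m => by positivity) (fun m => ?_)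
    ((summable_theta _ (by positivity) hθ).mul_left A)
  refine (mul_le_mul_of_nonneg_right (h m) (by positivity)).trans (le_of_eq ?_)
  rw [mul_pow]; ring

lemma exists_series {F : (Fin 3 → ℝ) → ℝ} (hF : AnalyticAt ℝ F 0) :
    ∃ (f : PS) (A B : ℝ), 0 < A ∧ 0 < B ∧ (∀ m, |coeff m f| ≤ A * B ^ m.degree) ∧
      ∃ r, 0 < r ∧ r ≤ 1 / B ∧ ∀ q ∈ bx r, Ev f q = F q := by
  obtain ⟨p, R, hp⟩ := hF
  obtain ⟨s, hs0, hsR⟩ := ENNReal.lt_iff_exists_nnreal_btwn.1 hp.r_pos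
  have hs0' : 0 < s := by simpa using hs0
  have hsp : (0 : ℝ) < s := hs0'
  obtain ⟨C, hC, hb⟩ := p.norm_mul_pow_le_of_lt_radius (hsR.trans_le hp.r_le)
  have hbd : ∀ m, |coeff m (cf p)| ≤ C * (3 / s) ^ m.degree := by
    intro m
    refine (cf_bound p m).trans ?_
    have := hb m.degree
    rw [div_pow, mul_div_assoc', le_div_iff₀ (by positivity)]
    have h3 : (0 : ℝ) < 3 ^ m.degree := by positivity
    nlinarith
  have hcv := Cv_of_bound (by positivity) hbd
  refine ⟨cf p, C, 3 / s, hC, by positivity, hbd, 1 / (3 / s), by positivity, le_rfl, fun q hq => ?_⟩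
  have h2 : HasSum (fun n => p n fun _ => q) (F q) := by
    have := hp.hasSum (y := q) ?_
    · simpa using this
    · refine Metric.eball_subset_eball hsR.le ?_
      rw [← ENNReal.ofReal_coe_nnreal, Metric.eball_ofReal, Metric.mem_ball, dist_zero_right, pi_norm_lt_iff hsp]
      intro i
      refine (hq i).trans_le ?_
      rw [one_div_div]
      linarith
  simp only [p_expand] at h2
  exact (hasSum_degree hcv hq).unique h2

/-- geometric bound implies weighted bound. -/
lemma Bd_of_bound {f : PS} {A B : ℝ} (hA : 0 < A) (hB : 0 < B) (h : ∀ m, |coeff m f| ≤ A * B ^ m.degree) (β : ℝ)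
    (hβ : 2 * B ≤ β) :
    ∀ ε a, Adm β ε a → Bd a f (32 * A) := by
  intro ε a ha m
  have h1 : ((m.degree : ℝ) + 1) ^ 2 ≤ 4 * 2 ^ m.degree := by
    generalize m.degree = n
    have hh : ∀ n : ℕ, ((n : ℝ) + 1) ^ 2 ≤ 4 * 2 ^ n ∧ (2 * (n : ℝ) + 3) ≤ 4 * 2 ^ n := by
      intro n
      induction n with
      | zero => norm_num
      | succ n ih =>
        rw [pow_succ (2 : ℝ) n]; push_cast
        constructor
        · nlinarith [ih.1, ih.2]
        · linarith [ih.1, ih.2, one_le_pow₀ (M₀ := ℝ) (a := 2) (by norm_num) (n := n)]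
    exact (hh n).1
  have h2 := cc_lower a β ha.beta_pos ha.le m
  have h3 : (2 * B) ^ m.degree ≤ β ^ m.degree := pow_le_pow_left₀ (by positivity) hβ _
  have h4 : (0 : ℝ) < ((m.degree : ℝ) + 1) ^ 2 := by positivity
  refine (h m).trans ?_
  unfold wt bb
  rw [mul_assoc, show 32 * (A * (1 / (8 * ((m.degree : ℝ) + 1) ^ 2) * cc a m)) =
    A * (4 * cc a m / ((m.degree : ℝ) + 1) ^ 2) by field_simp; ring]
  refine mul_le_mul_of_nonneg_left ?_ hA.le
  rw [le_div_iff₀ h4]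
  rw [mul_pow] at h3
  have h5 : 0 < B ^ m.degree := by positivity
  nlinarith

end CK

namespace CK

lemma gram_codazzi (a b c a' b' c' A1 A2 A3 C1 C2 C3 B1 B2 B3 L M N n l : ℝ)
    (hd : 0 < (a * a + b * b + c * c) * (a' * a' + b' * b' + c' * c') - (a * a' + b * b' + c * c') ^ 2)
    (hV1 : (N * A1 - 2 * M * C1 + L * B1 + n * a - l * a') * a + (N * A2 - 2 * M * C2 + L * B2 + n * b - l * b') * b
      + (N * A3 - 2 * M * C3 + L * B3 + n * c - l * c') * c = 0)
    (hV2 : (N * A1 - 2 * M * C1 + L * B1 + n * a - l * a') * a' + (N * A2 - 2 * M * C2 + L * B2 + n * b - l * b') * b'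
      + (N * A3 - 2 * M * C3 + L * B3 + n * c - l * c') * c' = 0)
    (g11 g12 g22 g111 g112 g121 g122 g221 g222 dt : ℝ)
    (e11 : g11 = a * a + b * b + c * c) (e12 : g12 = a * a' + b * b' + c * c')
    (e22 : g22 = a' * a' + b' * b' + c' * c')
    (e111 : g111 = 2 * (a * A1 + b * A2 + c * A3)) (e112 : g112 = 2 * (a * C1 + b * C2 + c * C3))
    (e121 : g121 = a' * A1 + b' * A2 + c' * A3 + (a * C1 + b * C2 + c * C3))
    (e122 : g122 = a' * C1 + b' * C2 + c' * C3 + (a * B1 + b * B2 + c * B3))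
    (e221 : g221 = 2 * (a' * C1 + b' * C2 + c' * C3)) (e222 : g222 = 2 * (a' * B1 + b' * B2 + c' * B3))
    (edt : dt = g11 * g22 - g12 ^ 2) :
    n = -((g22 * (2 * g122 - g221) - g12 * g222) / (2 * dt)) * L
      + 2 * ((g22 * g112 - g12 * g221) / (2 * dt)) * M
      - ((g22 * g111 - g12 * (2 * g121 - g112)) / (2 * dt)) * N ∧
    l = ((-g12 * (2 * g122 - g221) + g11 * g222) / (2 * dt)) * L
      - 2 * ((-g12 * g112 + g11 * g221) / (2 * dt)) * M
      + ((-g12 * g111 + g11 * (2 * g121 - g112)) / (2 * dt)) * N := by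
  have hdt : dt ≠ 0 := by
    rw [edt, e11, e12, e22]; exact hd.ne'
  constructor
  · field_simp
    rw [e111, e112, e121, e122, e221, e222]
    have : dt * n * 2 = 2 * n * (g11 * g22 - g12 ^ 2) := by rw [edt]; ring
    have h3 : dt * n = n * (g11 * g22 - g12 ^ 2) := by rw [edt]; ring
    rw [e11] at h3
    rw [e12, e22] at *
    linear_combination 2 * h3 + 2 * (a' * a' + b' * b' + c' * c') * hV1 - 2 * (a * a' + b * b' + c * c') * hV2
  · field_simp
    rw [e111, e112, e121, e122, e221, e222]
    have h3 : dt * l = l * (g11 * g22 - g12 ^ 2) := by rw [edt]; ring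
    rw [e22] at h3
    rw [e12, e11] at *
    linear_combination 2 * h3 + 2 * (a * a' + b * b' + c * c') * hV1 - 2 * (a * a + b * b + c * c) * hV2

lemma gram_brioschi (a b c a' b' c' A1 A2 A3 C1 C2 C3 B1 B2 B3 κ : ℝ)
    (hd : 0 < (a * a + b * b + c * c) * (a' * a' + b' * b' + c' * c') - (a * a' + b * b' + c * c') ^ 2)
    (g11 g12 g22 g111 g112 g121 g122 g221 g222 B0 dt : ℝ)
    (e11 : g11 = a * a + b * b + c * c) (e12 : g12 = a * a' + b * b' + c * c')
    (e22 : g22 = a' * a' + b' * b' + c' * c')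
    (e111 : g111 = 2 * (a * A1 + b * A2 + c * A3)) (e112 : g112 = 2 * (a * C1 + b * C2 + c * C3))
    (e121 : g121 = a' * A1 + b' * A2 + c' * A3 + (a * C1 + b * C2 + c * C3))
    (e122 : g122 = a' * C1 + b' * C2 + c' * C3 + (a * B1 + b * B2 + c * B3))
    (e221 : g221 = 2 * (a' * C1 + b' * C2 + c' * C3)) (e222 : g222 = 2 * (a' * B1 + b' * B2 + c' * B3))
    (eB0 : B0 = 2 * (A1 * B1 + A2 * B2 + A3 * B3 - (C1 * C1 + C2 * C2 + C3 * C3)))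
    (edt : dt = g11 * g22 - g12 ^ 2)
    (hK : 4 * ((A1 * (b * c' - c * b') + A2 * (c * a' - a * c') + A3 * (a * b' - b * a'))
      * (B1 * (b * c' - c * b') + B2 * (c * a' - a * c') + B3 * (a * b' - b * a'))
      - (C1 * (b * c' - c * b') + C2 * (c * a' - a * c') + C3 * (a * b' - b * a')) ^ 2) = dt ^ 2 * κ) :
    κ = (1 / (2 * dt ^ 2)) * Matrix.det !![B0, g111, 2 * g121 - g112; 2 * g122 - g221, 2 * g11, 2 * g12;
        g222, 2 * g12, 2 * g22]
      - (1 / (2 * dt ^ 2)) * Matrix.det !![0, g112, g221; g112, 2 * g11, 2 * g12; g221, 2 * g12, 2 * g22] := by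
  have hdt : dt ≠ 0 := by
    rw [edt, e11, e12, e22]; exact hd.ne'
  rw [← mul_sub, Matrix.det_fin_three, Matrix.det_fin_three]
  simp only [Matrix.of_apply, Matrix.cons_val', Matrix.cons_val_zero, Matrix.cons_val_one, Matrix.cons_val]
  rw [one_div, inv_mul_eq_div, eq_div_iff (by positivity)]
  have h2 : κ * (2 * dt ^ 2) = 2 * (dt ^ 2 * κ) := by ring
  rw [h2, ← hK, eB0, e111, e112, e121, e122, e221, e222, e11, e12, e22]
  ring

/-- algebra of the local graph representation -/
lemma geomR (x1 x2 y1 y2 x11 x12 x22 y11 y12 y22 P Q P1 P2 Q1 Q2 W W1 W2 L M N n l : ℝ)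
    (h1 : N * x1 - M * x2 = 2 * (W * Q2)) (h2 : N * y1 - M * y2 = -(2 * (W * P2)))
    (h3 : 2 * P1 = (1 + P * P + Q * Q) * (L * y2 - M * y1))
    (h4 : 2 * Q1 = (1 + P * P + Q * Q) * (M * x1 - L * x2))
    (hW : W * (1 + P * P + Q * Q) = 1)
    (hVx : N * x11 - 2 * M * x12 + L * x22 + n * x1 - l * x2 = 2 * (W1 * Q2 - W2 * Q1))
    (hVy : N * y11 - 2 * M * y12 + L * y22 + n * y1 - l * y2 = -2 * (W1 * P2 - W2 * P1))
    (hW1 : W1 * (1 + P * P + Q * Q) + 2 * W * (P * P1 + Q * Q1) = 0)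
    (hW2 : W2 * (1 + P * P + Q * Q) + 2 * W * (P * P2 + Q * Q2) = 0) :
    ∃ J w : ℝ, J = x1 * y2 - x2 * y1 ∧ w = 1 + P * P + Q * Q ∧
    P2 * x1 + Q2 * y1 = P1 * x2 + Q1 * y2 ∧
    2 * (P1 * x1 + Q1 * y1) = L * J * w ∧ 2 * (P2 * x1 + Q2 * y1) = M * J * w ∧ 2 * (P2 * x2 + Q2 * y2) = N * J * w ∧
    ∃ Vz : ℝ, N * x11 - 2 * M * x12 + L * x22 + n * x1 - l * x2 = - P * Vz ∧
      N * y11 - 2 * M * y12 + L * y22 + n * y1 - l * y2 = - Q * Vz ∧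
      N * (P * x11 + Q * y11 + P1 * x1 + Q1 * y1) - 2 * M * (P * x12 + Q * y12 + P2 * x1 + Q2 * y1)
        + L * (P * x22 + Q * y22 + P2 * x2 + Q2 * y2) + n * (P * x1 + Q * y1) - l * (P * x2 + Q * y2) = Vz := by
  have h5 : 2 * P2 = (1 + P * P + Q * Q) * (M * y2 - N * y1) := by
    linear_combination (1 + P * P + Q * Q) * h2 - 2 * P2 * hW
  have h6 : 2 * Q2 = (1 + P * P + Q * Q) * (N * x1 - M * x2) := by
    linear_combination -(1 + P * P + Q * Q) * h1 - 2 * Q2 * hW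
  have k1 : W1 = - 2 * W * W * (P * P1 + Q * Q1) := by
    linear_combination W * hW1 - W1 * hW
  have k2 : W2 = - 2 * W * W * (P * P2 + Q * Q2) := by
    linear_combination W * hW2 - W2 * hW
  have m1 : 2 * (P1 * x1 + Q1 * y1) = L * (x1 * y2 - x2 * y1) * (1 + P * P + Q * Q) := by
    linear_combination x1 * h3 + y1 * h4
  have m2 : 2 * (P2 * x1 + Q2 * y1) = M * (x1 * y2 - x2 * y1) * (1 + P * P + Q * Q) := by
    linear_combination x1 * h5 + y1 * h6
  have m2' : 2 * (P1 * x2 + Q1 * y2) = M * (x1 * y2 - x2 * y1) * (1 + P * P + Q * Q) := by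
    linear_combination x2 * h3 + y2 * h4
  have m3 : 2 * (P2 * x2 + Q2 * y2) = N * (x1 * y2 - x2 * y1) * (1 + P * P + Q * Q) := by
    linear_combination x2 * h5 + y2 * h6
  have hD : 4 * (P1 * Q2 - P2 * Q1) = (1 + P * P + Q * Q) ^ 2 * ((L * N - M ^ 2) * (x1 * y2 - x2 * y1)) := by
    linear_combination 2 * Q2 * h3 + (1 + P * P + Q * Q) * (L * y2 - M * y1) * h6 - 2 * Q1 * h5
      - (1 + P * P + Q * Q) * (M * y2 - N * y1) * h4
  have hVx' : N * x11 - 2 * M * x12 + L * x22 + n * x1 - l * x2 = - P * (4 * W * W * (P1 * Q2 - P2 * Q1)) := by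
    rw [hVx, k1, k2]; ring
  have hVy' : N * y11 - 2 * M * y12 + L * y22 + n * y1 - l * y2 = - Q * (4 * W * W * (P1 * Q2 - P2 * Q1)) := by
    rw [hVy, k1, k2]; ring
  refine ⟨_, _, rfl, rfl, by linarith, m1, m2, m3, 4 * W * W * (P1 * Q2 - P2 * Q1), hVx', hVy', ?_⟩
  have hWW : W * W * (1 + P * P + Q * Q) ^ 2 = 1 := by
    linear_combination (W * (1 + P * P + Q * Q) + 1) * hW
  have hs : N * (P1 * x1 + Q1 * y1) - 2 * M * (P2 * x1 + Q2 * y1) + L * (P2 * x2 + Q2 * y2)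
      = (L * N - M ^ 2) * (x1 * y2 - x2 * y1) * (1 + P * P + Q * Q) := by
    linear_combination N / 2 * m1 - M * m2 + L / 2 * m3
  have e : 4 * W * W * (P1 * Q2 - P2 * Q1) = (L * N - M ^ 2) * (x1 * y2 - x2 * y1) := by
    linear_combination W * W * hD + (L * N - M ^ 2) * (x1 * y2 - x2 * y1) * hWW
  rw [e] at hVx' hVy' ⊢
  linear_combination P * hVx' + Q * hVy' + hs

end CK

namespace CK

section formal
variable {R : Type*} [CommRing R] (D0 D1 : Derivation ℤ R R)

lemma comp_B0 (hcomm : ∀ f, D0 (D1 f) = D1 (D0 f)) (z1 z2 : R) (h : D1 z1 = D0 z2) :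
    -(D1 (D1 (z1 * z1))) + (D0 (D1 (z1 * z2)) + D0 (D1 (z1 * z2))) - D0 (D0 (z2 * z2))
      = (D0 z1 * D1 z2 - D1 z1 * D1 z1) + (D0 z1 * D1 z2 - D1 z1 * D1 z1) := by
  have e1 : D0 (D0 z2) = D0 (D1 z1) := by rw [h]
  have e2 : D1 (D1 z1) = D0 (D1 z2) := by rw [h, hcomm]
  simp only [Derivation.leibniz, map_add, smul_eq_mul]
  rw [e1, e2, ← h]
  ring

lemma formal_V (hcomm : ∀ f, D0 (D1 f) = D1 (D0 f)) (x Q W L M N : R)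
    (h1 : N * D0 x - M * D1 x = W * D1 Q + W * D1 Q)
    (h4 : M * D0 x - L * D1 x = W * D0 Q + W * D0 Q) :
    N * D0 (D0 x) - 2 * M * D1 (D0 x) + L * D1 (D1 x) + (D0 N - D1 M) * D0 x - (D0 M - D1 L) * D1 x
      = 2 * (D0 W * D1 Q - D1 W * D0 Q) := by
  have k1 := congrArg D0 h1
  have k4 := congrArg D1 h4
  simp only [Derivation.leibniz, map_add, map_sub, smul_eq_mul, hcomm] at k1 k4
  linear_combination k1 - k4

lemma formal_W (P Q W : R) (hW : W * (1 + P * P + Q * Q) = 1) :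
    D0 W * (1 + P * P + Q * Q) + 2 * W * (P * D0 P + Q * D0 Q) = 0 := by
  have k := congrArg D0 hW
  simp only [Derivation.leibniz, map_add, smul_eq_mul, Derivation.map_one_eq_zero] at k
  linear_combination k

set_option linter.unusedSimpArgs false in
set_option maxHeartbeats 2000000 in
/-- the main geometric computation -/
lemma formal_main (hcomm : ∀ f, D0 (D1 f) = D1 (D0 f)) (E : R →+* ℝ)
    (hcan : ∀ f g : R, f + f = g + g → f = g)
    (x y P Q W L M N g11 g12 g22 : R)
    (h1 : N * D0 x - M * D1 x = W * D1 Q + W * D1 Q)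
    (h2 : N * D0 y - M * D1 y = -(W * D1 P + W * D1 P))
    (h3 : D0 P + D0 P = (1 + P * P + Q * Q) * (L * D1 y - M * D0 y))
    (h4 : D0 Q + D0 Q = (1 + P * P + Q * Q) * (M * D0 x - L * D1 x))
    (hW : W * (1 + P * P + Q * Q) = 1)
    (e11 : g11 = D0 x * D0 x + D0 y * D0 y + (P * D0 x + Q * D0 y) * (P * D0 x + Q * D0 y))
    (e12 : g12 = D0 x * D1 x + D0 y * D1 y + (P * D0 x + Q * D0 y) * (P * D1 x + Q * D1 y))
    (e22 : g22 = D1 x * D1 x + D1 y * D1 y + (P * D1 x + Q * D1 y) * (P * D1 x + Q * D1 y))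
    (hJ : E (D0 x * D1 y - D1 x * D0 y) ≠ 0) (dt : ℝ)
    (edt : dt = E g11 * E g22 - E g12 ^ 2) :
    0 < dt ∧
    E (D0 N) - E (D1 M) =
      -((E g22 * (2 * E (D1 g12) - E (D0 g22)) - E g12 * E (D1 g22)) / (2 * dt)) * E L
      + 2 * ((E g22 * E (D1 g11) - E g12 * E (D0 g22)) / (2 * dt)) * E M
      - ((E g22 * E (D0 g11) - E g12 * (2 * E (D0 g12) - E (D1 g11))) / (2 * dt)) * E N ∧
    E (D0 M) - E (D1 L) = ((-E g12 * (2 * E (D1 g12) - E (D0 g22)) + E g11 * E (D1 g22)) / (2 * dt)) * E L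
      - 2 * ((-E g12 * E (D1 g11) + E g11 * E (D0 g22)) / (2 * dt)) * E M
      + ((-E g12 * E (D0 g11) + E g11 * (2 * E (D0 g12) - E (D1 g11))) / (2 * dt)) * E N ∧
    E L * E N - E M ^ 2 = (1 / (2 * dt ^ 2)) * Matrix.det
        !![-(E (D1 (D1 g11))) + 2 * E (D0 (D1 g12)) - E (D0 (D0 g22)), E (D0 g11), 2 * E (D0 g12) - E (D1 g11);
           2 * E (D1 g12) - E (D0 g22), 2 * E g11, 2 * E g12; E (D1 g22), 2 * E g12, 2 * E g22]
      - (1 / (2 * dt ^ 2)) * Matrix.det !![0, E (D1 g11), E (D0 g22); E (D1 g11), 2 * E g11, 2 * E g12;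
          E (D0 g22), 2 * E g12, 2 * E g22] := by
  have h3w : M * D0 y - L * D1 y = W * D0 (-P) + W * D0 (-P) := by
    rw [map_neg]; linear_combination W * h3 + (M * D0 y - L * D1 y) * (-hW)
  have h4w : M * D0 x - L * D1 x = W * D0 Q + W * D0 Q := by
    linear_combination -W * h4 - (M * D0 x - L * D1 x) * hW
  have h2w : N * D0 y - M * D1 y = W * D1 (-P) + W * D1 (-P) := by
    rw [map_neg]; linear_combination h2
  have hVx := formal_V D0 D1 hcomm x Q W L M N h1 h4w
  have hVy := formal_V D0 D1 hcomm y (-P) W L M N h2w h3w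
  have hW0 := formal_W D0 P Q W hW
  have hW1 := formal_W D1 P Q W hW
  have hc : D1 P * D0 x + D1 Q * D0 y = D0 P * D1 x + D0 Q * D1 y := by
    apply hcan
    have h5 : D1 P + D1 P = (1 + P * P + Q * Q) * (M * D1 y - N * D0 y) := by
      linear_combination (1 + P * P + Q * Q) * h2 - 2 * D1 P * hW
    have h6 : D1 Q + D1 Q = (1 + P * P + Q * Q) * (N * D0 x - M * D1 x) := by
      linear_combination -(1 + P * P + Q * Q) * h1 - 2 * D1 Q * hW
    linear_combination D0 x * h5 + D0 y * h6 - D1 x * h3 - D1 y * h4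
  have hz : D1 (P * D0 x + Q * D0 y) = D0 (P * D1 x + Q * D1 y) := by
    simp only [Derivation.leibniz, map_add, smul_eq_mul, hcomm]
    linear_combination hc
  -- derivatives of the metric
  have z1a : D0 (P * D0 x + Q * D0 y) = P * D0 (D0 x) + Q * D0 (D0 y) + D0 P * D0 x + D0 Q * D0 y := by
    simp only [Derivation.leibniz, map_add, smul_eq_mul]; ring
  have z1b : D1 (P * D0 x + Q * D0 y) = P * D1 (D0 x) + Q * D1 (D0 y) + D1 P * D0 x + D1 Q * D0 y := by
    simp only [Derivation.leibniz, map_add, smul_eq_mul]; ring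
  have z2b : D1 (P * D1 x + Q * D1 y) = P * D1 (D1 x) + Q * D1 (D1 y) + D1 P * D1 x + D1 Q * D1 y := by
    simp only [Derivation.leibniz, map_add, smul_eq_mul]; ring
  generalize hz1 : P * D0 x + Q * D0 y = z1 at *
  generalize hz2 : P * D1 x + Q * D1 y = z2 at *
  have f111 : D0 g11 = 2 * (D0 x * D0 (D0 x) + D0 y * D0 (D0 y) + z1 * D0 z1) := by
    rw [e11]; simp only [Derivation.leibniz, map_add, smul_eq_mul]; ring
  have f112 : D1 g11 = 2 * (D0 x * D1 (D0 x) + D0 y * D1 (D0 y) + z1 * D1 z1) := by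
    rw [e11]; simp only [Derivation.leibniz, map_add, smul_eq_mul]; ring
  have f121 : D0 g12 = D1 x * D0 (D0 x) + D1 y * D0 (D0 y) + z2 * D0 z1
      + (D0 x * D1 (D0 x) + D0 y * D1 (D0 y) + z1 * D1 z1) := by
    rw [e12, hz]; simp only [Derivation.leibniz, map_add, smul_eq_mul, hcomm]; ring
  have f122 : D1 g12 = D1 x * D1 (D0 x) + D1 y * D1 (D0 y) + z2 * D1 z1
      + (D0 x * D1 (D1 x) + D0 y * D1 (D1 y) + z1 * D1 z2) := by
    rw [e12]; simp only [Derivation.leibniz, map_add, smul_eq_mul, hcomm]; ring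
  have f221 : D0 g22 = 2 * (D1 x * D1 (D0 x) + D1 y * D1 (D0 y) + z2 * D1 z1) := by
    rw [e22, hz]; simp only [Derivation.leibniz, map_add, smul_eq_mul, hcomm]; ring
  have f222 : D1 g22 = 2 * (D1 x * D1 (D1 x) + D1 y * D1 (D1 y) + z2 * D1 z2) := by
    rw [e22]; simp only [Derivation.leibniz, map_add, smul_eq_mul]; ring
  have fB0 : -(D1 (D1 g11)) + 2 * D0 (D1 g12) - D0 (D0 g22)
      = 2 * (D0 (D0 x) * D1 (D1 x) + D0 (D0 y) * D1 (D1 y) + D0 z1 * D1 z2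
        - (D1 (D0 x) * D1 (D0 x) + D1 (D0 y) * D1 (D0 y) + D1 z1 * D1 z1)) := by
    have c1 := comp_B0 D0 D1 hcomm (D0 x) (D1 x) (hcomm x).symm
    have c2 := comp_B0 D0 D1 hcomm (D0 y) (D1 y) (hcomm y).symm
    have c3 := comp_B0 D0 D1 hcomm z1 z2 hz
    rw [e11, e12, e22]
    simp only [map_add]
    linear_combination c1 + c2 + c3
  have t2 : E 2 = 2 := map_ofNat E 2
  -- transfer
  obtain ⟨J, w, eJ, ew, -, m1, m2, m3, Vz, v1, v2, v3⟩ := geomR (E (D0 x)) (E (D1 x)) (E (D0 y)) (E (D1 y))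
    (E (D0 (D0 x))) (E (D1 (D0 x))) (E (D1 (D1 x))) (E (D0 (D0 y))) (E (D1 (D0 y))) (E (D1 (D1 y)))
    (E P) (E Q) (E (D0 P)) (E (D1 P)) (E (D0 Q)) (E (D1 Q)) (E W) (E (D0 W)) (E (D1 W)) (E L) (E M) (E N)
    (E (D0 N) - E (D1 M)) (E (D0 M) - E (D1 L))
    (by have := congrArg E h1; simp only [map_add, map_sub, map_mul, map_neg] at this; linear_combination this)
    (by have := congrArg E h2; simp only [map_add, map_sub, map_mul, map_neg] at this; linear_combination this)
    (by have := congrArg E h3; simp only [map_add, map_sub, map_mul, map_neg, map_one] at this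
        linear_combination this)
    (by have := congrArg E h4; simp only [map_add, map_sub, map_mul, map_neg, map_one] at this
        linear_combination this)
    (by have := congrArg E hW; simpa only [map_add, map_sub, map_mul, map_neg, map_one] using this)
    (by have := congrArg E hVx; simpa only [map_add, map_sub, map_mul, map_neg, map_one, t2] using this)
    (by have := congrArg E hVy; simp only [map_add, map_sub, map_mul, map_neg, map_one, t2] at this
        linear_combination this)
    (by have := congrArg E hW0; simpa only [map_add, map_sub, map_mul, map_neg, map_one, map_zero, t2] using this)
    (by have := congrArg E hW1; simpa only [map_add, map_sub, map_mul, map_neg, map_one, map_zero, t2] using this)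
  have r11 := congrArg E e11
  have r12 := congrArg E e12
  have r22 := congrArg E e22
  replace f111 := congrArg E f111
  replace f112 := congrArg E f112
  replace f121 := congrArg E f121
  replace f122 := congrArg E f122
  replace f221 := congrArg E f221
  replace f222 := congrArg E f222
  replace fB0 := congrArg E fB0
  have s1 := congrArg E hz1
  have s2 := congrArg E hz2
  replace z1a := congrArg E z1a
  replace z1b := congrArg E z1b
  replace z2b := congrArg E z2b
  simp only [map_add, map_sub, map_mul, map_neg, t2] at r11 r12 r22 f111 f112 f121 f122 f221 f222 fB0 s1 s2 z1a z1b z2b hJ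
  rw [← z1a, ← z1b, ← z2b, s1, s2] at v3
  have hJ' : J ≠ 0 := by rw [eJ]; exact hJ
  have hwpos : 0 < w := by rw [ew]; nlinarith [mul_self_nonneg (E P), mul_self_nonneg (E Q)]
  have hdt : dt = J ^ 2 * w := by
    rw [edt, r11, r12, r22, eJ, ew, ← s1, ← s2]; ring
  have hpos : 0 < dt := by rw [hdt]; positivity
  have hd := hpos
  rw [edt, r11, r12, r22] at hd
  have hcod := gram_codazzi (E (D0 x)) (E (D0 y)) (E z1) (E (D1 x)) (E (D1 y)) (E z2)
    (E (D0 (D0 x))) (E (D0 (D0 y))) (E (D0 z1)) (E (D1 (D0 x))) (E (D1 (D0 y))) (E (D1 z1))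
    (E (D1 (D1 x))) (E (D1 (D1 y))) (E (D1 z2)) (E L) (E M) (E N) (E (D0 N) - E (D1 M)) (E (D0 M) - E (D1 L))
    hd (by rw [v1, v2, v3, ← s1]; ring) (by rw [v1, v2, v3, ← s2]; ring)
    _ _ _ _ _ _ _ _ _ dt r11 r12 r22 f111 f112 f121 f122 f221 f222 edt
  have hbr := gram_brioschi (E (D0 x)) (E (D0 y)) (E z1) (E (D1 x)) (E (D1 y)) (E z2)
    (E (D0 (D0 x))) (E (D0 (D0 y))) (E (D0 z1)) (E (D1 (D0 x))) (E (D1 (D0 y))) (E (D1 z1))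
    (E (D1 (D1 x))) (E (D1 (D1 y))) (E (D1 z2)) (E L * E N - E M ^ 2) hd
    _ _ _ _ _ _ _ _ _ _ dt r11 r12 r22 f111 f112 f121 f122 f221 f222 fB0 edt (by
      have dA : E (D0 (D0 x)) * (E (D0 y) * E z2 - E z1 * E (D1 y)) + E (D0 (D0 y)) * (E z1 * E (D1 x) - E (D0 x) * E z2)
          + E (D0 z1) * (E (D0 x) * E (D1 y) - E (D0 y) * E (D1 x)) = J * (E (D0 P) * E (D0 x) + E (D0 Q) * E (D0 y)) := by
        rw [z1a, ← s1, ← s2, eJ]; ring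
      have dC : E (D1 (D0 x)) * (E (D0 y) * E z2 - E z1 * E (D1 y)) + E (D1 (D0 y)) * (E z1 * E (D1 x) - E (D0 x) * E z2)
          + E (D1 z1) * (E (D0 x) * E (D1 y) - E (D0 y) * E (D1 x)) = J * (E (D1 P) * E (D0 x) + E (D1 Q) * E (D0 y)) := by
        rw [z1b, ← s1, ← s2, eJ]; ring
      have dB : E (D1 (D1 x)) * (E (D0 y) * E z2 - E z1 * E (D1 y)) + E (D1 (D1 y)) * (E z1 * E (D1 x) - E (D0 x) * E z2)
          + E (D1 z2) * (E (D0 x) * E (D1 y) - E (D0 y) * E (D1 x)) = J * (E (D1 P) * E (D1 x) + E (D1 Q) * E (D1 y)) := by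
        rw [z2b, ← s1, ← s2, eJ]; ring
      rw [dA, dB, dC, hdt]
      have q : 4 * (J * (E (D0 P) * E (D0 x) + E (D0 Q) * E (D0 y)) * (J * (E (D1 P) * E (D1 x) + E (D1 Q) * E (D1 y)))
        - (J * (E (D1 P) * E (D0 x) + E (D1 Q) * E (D0 y))) ^ 2)
        = J ^ 2 * ((2 * (E (D0 P) * E (D0 x) + E (D0 Q) * E (D0 y))) * (2 * (E (D1 P) * E (D1 x) + E (D1 Q) * E (D1 y)))
          - (2 * (E (D1 P) * E (D0 x) + E (D1 Q) * E (D0 y))) ^ 2) := by ring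
      rw [q, m1, m2, m3]; ring)
  exact ⟨hpos, hcod.1, hcod.2, hbr⟩

end formal
end CK

namespace CK
open MvPowerSeries Finsupp

lemma deriv_of {r : ℝ} {f : PS} (hf : Cv r f) {F : (Fin 3 → ℝ) → ℝ} (h : ∀ q ∈ bx r, F q = Ev f q)
    {q : Fin 3 → ℝ} (hq : q ∈ bx r) (i : Fin 3) :
    deriv (fun s => F (Function.update q i s)) (q i) = Ev (dd i f) q := by
  have h2 := hasDeriv_Ev hf hq i
  have h3 : (fun s => F (Function.update q i s)) =ᶠ[nhds (q i)] fun s => Ev f (Function.update q i s) := by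
    have : Set.Ioo (-r) r ∈ nhds (q i) := Ioo_mem_nhds (abs_lt.1 (hq i)).1 (abs_lt.1 (hq i)).2
    filter_upwards [this] with s hs
    refine h _ fun j => ?_
    by_cases hj : j = i
    · subst hj; simpa using abs_lt.2 hs
    · rw [Function.update_of_ne hj]; exact hq j
  exact (h2.congr_of_eventuallyEq h3).deriv

lemma bx_mono {r s : ℝ} (h : r ≤ s) : bx r ⊆ bx s := fun _ hq i => (hq i).trans_le h

lemma bx_nhds {r : ℝ} {s : Set (Fin 3 → ℝ)} (hs : s ∈ nhds (0 : Fin 3 → ℝ)) (hr : 0 < r) :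
    ∃ ε, 0 < ε ∧ ε ≤ r ∧ bx ε ⊆ s := by
  obtain ⟨δ, hδ, h⟩ := Metric.mem_nhds_iff.1 hs
  refine ⟨min δ r, lt_min hδ hr, min_le_right _ _, fun q hq => h ?_⟩
  rw [Metric.mem_ball, dist_zero_right, pi_norm_lt_iff hδ]
  intro i
  exact (hq i).trans_le (min_le_left _ _)

lemma zero_of_Ev {r : ℝ} (hr : 0 < r) {f : PS} (hf : Cv r f) (h : ∀ q ∈ bx r, Ev f q = 0) : f = 0 := by
  ext m
  rw [Ev_inj hr m f hf h, map_zero]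

lemma initial_series (S : Set (ℝ × ℝ)) (hS : IsOpen S) (hS0 : ((0 : ℝ), (0 : ℝ)) ∈ S)
    (u0 v0 : ℝ × ℝ → ℝ) (hu0 : AnalyticOnNhd ℝ u0 S) (hv0 : AnalyticOnNhd ℝ v0 S)
    (hdiv0 : ∀ x ∈ S, sd1 u0 x + sd2 v0 x = 0) :
    ∃ (U0 V0 : PS) (β A r : ℝ), 0 < β ∧ 0 ≤ A ∧ 0 < r ∧ (∀ ε a, Adm β ε a → Bd a U0 A) ∧
      (∀ ε a, Adm β ε a → Bd a V0 A) ∧ dd 2 U0 = 0 ∧ dd 2 V0 = 0 ∧ dd 0 U0 + dd 1 V0 = 0 ∧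
      ∀ q ∈ bx r, (q 0, q 1) ∈ S ∧ Ev U0 q = u0 (q 0, q 1) ∧ Ev V0 q = v0 (q 0, q 1) := by
  let pr : (Fin 3 → ℝ) →L[ℝ] ℝ × ℝ :=
    (ContinuousLinearMap.proj (R := ℝ) (φ := fun _ : Fin 3 => ℝ) 0).prod
      (ContinuousLinearMap.proj (R := ℝ) (φ := fun _ : Fin 3 => ℝ) 1)
  have hpr : ∀ q, pr q = (q 0, q 1) := fun q => rfl
  have hp0 : pr 0 = (0, 0) := rfl
  have hU : AnalyticAt ℝ (fun q => u0 (pr q)) 0 :=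
    AnalyticAt.comp (g := u0) (f := pr) (by rw [hp0]; exact hu0 _ hS0) (pr.analyticAt 0)
  have hV : AnalyticAt ℝ (fun q => v0 (pr q)) 0 :=
    AnalyticAt.comp (g := v0) (f := pr) (by rw [hp0]; exact hv0 _ hS0) (pr.analyticAt 0)
  obtain ⟨U0, A, B, hA, hB, hb, r, hr, hrB, hE⟩ := exists_series hU
  obtain ⟨V0, A', B', hA', hB', hb', r', hr', hrB', hE'⟩ := exists_series hV
  have hpre : pr ⁻¹' S ∈ nhds (0 : Fin 3 → ℝ) :=
    (hS.preimage pr.continuous).mem_nhds (by rw [Set.mem_preimage, hp0]; exact hS0)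
  obtain ⟨ε, hε, hεr, hεS⟩ := bx_nhds hpre (lt_min hr hr')
  have l1 := hεr.trans (min_le_left _ _)
  have l2 := hεr.trans (min_le_right _ _)
  have cU : Cv ε U0 := (Cv_of_bound hB hb).mono (l1.trans hrB)
  have cV : Cv ε V0 := (Cv_of_bound hB' hb').mono (l2.trans hrB')
  have eU : ∀ q ∈ bx ε, u0 (q 0, q 1) = Ev U0 q := fun q hq => (hE q (bx_mono l1 hq)).symm
  have eV : ∀ q ∈ bx ε, v0 (q 0, q 1) = Ev V0 q := fun q hq => (hE' q (bx_mono l2 hq)).symm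
  refine ⟨U0, V0, 2 * max B B', 32 * max A A', ε, by positivity, by positivity, hε, ?_, ?_, ?_, ?_, ?_, ?_⟩
  · exact Bd_of_bound (hA.trans_le (le_max_left _ _)) hB (fun m => (hb m).trans (by
      gcongr; exact le_max_left _ _)) _ (by gcongr; exact le_max_left _ _)
  · exact Bd_of_bound (hA.trans_le (le_max_left _ _)) hB' (fun m => (hb' m).trans (by
      gcongr; exact le_max_right _ _)) _ (by gcongr; exact le_max_right _ _)
  · refine zero_of_Ev hε (cU.dd 2) fun q hq => ?_
    rw [← deriv_of cU eU hq 2]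
    simp
  · refine zero_of_Ev hε (cV.dd 2) fun q hq => ?_
    rw [← deriv_of cV eV hq 2]
    simp
  · refine zero_of_Ev hε ((cU.dd 0).add (cV.dd 1)) fun q hq => ?_
    rw [Ev_add (cU.dd 0) (cV.dd 1) hq, ← deriv_of cU eU hq 0, ← deriv_of cV eV hq 1]
    have := hdiv0 (q 0, q 1) (hεS hq)
    simpa [sd1, sd2] using this
  · intro q hq
    exact ⟨hεS hq, (eU q hq).symm, (eV q hq).symm⟩

/-- the ring of series converging on the box of radius `r` -/
def AA (r : ℝ) : Subring PS where
  carrier := {f | Cv r f}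
  mul_mem' := fun hf hg => Cv.mul hf hg
  one_mem' := Cv.one
  add_mem' := fun hf hg => Cv.add hf hg
  zero_mem' := Cv.zero
  neg_mem' := fun hf => Cv.neg hf

noncomputable def Dr (r : ℝ) (i : Fin 3) : Derivation ℤ (AA r) (AA r) :=
  Derivation.mk' (AddMonoidHom.toIntLinearMap
    { toFun := fun f => ⟨dd i f.1, Cv.dd f.2 i⟩
      map_zero' := Subtype.ext (by simp [dd])
      map_add' := fun f g => Subtype.ext (by simp [dd]) }) (fun f g => Subtype.ext (by
        simp only [AddMonoidHom.coe_toIntLinearMap, AddMonoidHom.coe_mk, ZeroHom.coe_mk, smul_eq_mul]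
        show dd i (f.1 * g.1) = f.1 * dd i g.1 + g.1 * dd i f.1
        rw [dd_mul]; ring))

lemma Dr_coe (r : ℝ) (i : Fin 3) (f : AA r) : ((Dr r i f : AA r) : PS) = dd i f.1 := rfl

lemma Dr_comm (r : ℝ) (i j : Fin 3) (f : AA r) : Dr r i (Dr r j f) = Dr r j (Dr r i f) :=
  Subtype.ext (dd_comm _ _ _)

noncomputable def Er (r : ℝ) (q : Fin 3 → ℝ) (hq : q ∈ bx r) : AA r →+* ℝ where
  toFun := fun f => Ev f.1 q
  map_one' := Ev_one q
  map_mul' := fun f g => Ev_mul f.2 g.2 hq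
  map_zero' := Ev_zero q
  map_add' := fun f g => Ev_add f.2 g.2 hq

lemma Er_apply (r : ℝ) (q : Fin 3 → ℝ) (hq : q ∈ bx r) (f : AA r) : Er r q hq f = Ev f.1 q := rfl

lemma AA_can (r : ℝ) (f g : AA r) (h : f + f = g + g) : f = g := by
  apply Subtype.ext
  ext m
  have h1 : f.1 + f.1 = g.1 + g.1 := congrArg Subtype.val h
  have := congrArg (coeff m) h1
  simp only [map_add] at this
  linarith

def vv (q : ℝ × ℝ × ℝ) : Fin 3 → ℝ := ![q.1, q.2.1, q.2.2]

lemma pdx1_of {r : ℝ} {f : AA r} {F : ℝ × ℝ × ℝ → ℝ} (h : ∀ q, vv q ∈ bx r → F q = Ev f.1 (vv q)) :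
    ∀ q, vv q ∈ bx r → pdx1 F q = Ev (Dr r 0 f).1 (vv q) := by
  intro q hq
  rw [Dr_coe, ← deriv_of (F := fun z => F (z 0, z 1, z 2)) f.2 (fun z hz => ?_) hq 0]
  · simp [pdx1, vv]
  · have e : vv (z 0, z 1, z 2) = z := by ext i; fin_cases i <;> rfl
    rw [h _ (by rw [e]; exact hz), e]

lemma pdx2_of {r : ℝ} {f : AA r} {F : ℝ × ℝ × ℝ → ℝ} (h : ∀ q, vv q ∈ bx r → F q = Ev f.1 (vv q)) :
    ∀ q, vv q ∈ bx r → pdx2 F q = Ev (Dr r 1 f).1 (vv q) := by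
  intro q hq
  rw [Dr_coe, ← deriv_of (F := fun z => F (z 0, z 1, z 2)) f.2 (fun z hz => ?_) hq 1]
  · simp [pdx2, vv]
  · have e : vv (z 0, z 1, z 2) = z := by ext i; fin_cases i <;> rfl
    rw [h _ (by rw [e]; exact hz), e]

lemma pdt_of {r : ℝ} {f : AA r} {F : ℝ × ℝ × ℝ → ℝ} (h : ∀ q, vv q ∈ bx r → F q = Ev f.1 (vv q)) :
    ∀ q, vv q ∈ bx r → pdt F q = Ev (Dr r 2 f).1 (vv q) := by
  intro q hq
  rw [Dr_coe, ← deriv_of (F := fun z => F (z 0, z 1, z 2)) f.2 (fun z hz => ?_) hq 2]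
  · simp [pdt, vv]
  · have e : vv (z 0, z 1, z 2) = z := by ext i; fin_cases i <;> rfl
    rw [h _ (by rw [e]; exact hz), e]

lemma vv_analytic (q : ℝ × ℝ × ℝ) : AnalyticAt ℝ vv q := by
  rw [analyticAt_pi_iff]
  intro i
  fin_cases i
  · exact analyticAt_fst
  · exact analyticAt_fst.comp analyticAt_snd
  · exact analyticAt_snd.comp analyticAt_snd

lemma an_of {r : ℝ} (hr : 0 < r) (f : AA r) {D : Set (ℝ × ℝ × ℝ)} (hD : ∀ q ∈ D, vv q ∈ bx r) :
    AnalyticOnNhd ℝ (fun q => Ev f.1 (vv q)) D := by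
  intro q hq
  exact AnalyticAt.comp (g := Ev f.1) (f := vv) (analytic_Ev hr f.2 _ (hD q hq)) (vv_analytic q)

lemma Ev_slice (f g : PS) (h : ∀ m, m 2 = 0 → coeff m f = coeff m g) (q : Fin 3 → ℝ) (hq : q 2 = 0) :
    Ev f q = Ev g q := by
  refine tsum_congr fun m => ?_
  by_cases hm : m 2 = 0
  · rw [h m hm]
  · have : mon q m = 0 := Finset.prod_eq_zero (Finset.mem_univ 2) (by rw [hq, zero_pow hm])
    rw [this, mul_zero, mul_zero]

end CK

open CK

/-- Theorem 5.1: from analytic divergence-free initial data `(u₀, v₀)` with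
`u₀(0,0)v₀(0,0) ≠ 0`, there exist a local-in-space-time analytic solution `(u, v, p)`
of the incompressible Euler equations attaining the data at `t = 0`, together with an
evolving metric `g` with `det g > 0` satisfying the Gauss–Codazzi equations with
`L = v² + p`, `M = −uv`, `N = u² + p`; in particular the Gauss curvature of `g`
equals `p² + p(u² + v²)`. -/
theorem statement9 (S : Set (ℝ × ℝ)) (hS : IsOpen S) (hS0 : ((0 : ℝ), (0 : ℝ)) ∈ S)
    (u0 v0 : ℝ × ℝ → ℝ) (hu0 : AnalyticOnNhd ℝ u0 S) (hv0 : AnalyticOnNhd ℝ v0 S)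
    (hdiv0 : ∀ x ∈ S, sd1 u0 x + sd2 v0 x = 0)
    (hne : u0 (0, 0) * v0 (0, 0) ≠ 0) :
    ∃ (T : ℝ) (W : Set (ℝ × ℝ)), 0 < T ∧ IsOpen W ∧ ((0 : ℝ), (0 : ℝ)) ∈ W ∧ W ⊆ S ∧
    ∃ u v p g11 g12 g22 : ℝ × ℝ × ℝ → ℝ, ∃ D : Set (ℝ × ℝ × ℝ),
      D = {q : ℝ × ℝ × ℝ | (q.1, q.2.1) ∈ W ∧ q.2.2 ∈ Set.Ioo (-T) T} ∧
      AnalyticOnNhd ℝ u D ∧ AnalyticOnNhd ℝ v D ∧ AnalyticOnNhd ℝ p D ∧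
      AnalyticOnNhd ℝ g11 D ∧ AnalyticOnNhd ℝ g12 D ∧ AnalyticOnNhd ℝ g22 D ∧
      -- (i) the incompressible Euler equations with the prescribed initial data
      (∀ q ∈ D, pdx1 (fun r => (u r) ^ 2 + p r) q + pdx2 (fun r => u r * v r) q
        = -(pdt u q)) ∧
      (∀ q ∈ D, pdx1 (fun r => u r * v r) q + pdx2 (fun r => (v r) ^ 2 + p r) q
        = -(pdt v q)) ∧
      (∀ q ∈ D, pdx1 u q + pdx2 v q = 0) ∧
      (∀ x ∈ W, u (x.1, x.2, 0) = u0 x ∧ v (x.1, x.2, 0) = v0 x) ∧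
      -- (ii) positivity of `det g`
      (∀ q ∈ D, 0 < detg g11 g12 g22 q) ∧
      -- (iii) the Gauss–Codazzi equations and the curvature identity
      (∀ q ∈ D, GaussCodazzi (fun r => (v r) ^ 2 + p r) (fun r => -(u r * v r))
        (fun r => (u r) ^ 2 + p r) g11 g12 g22 q) ∧
      (∀ q ∈ D, brioschi g11 g12 g22 q = (p q) ^ 2 + p q * ((u q) ^ 2 + (v q) ^ 2)) := by
  obtain ⟨U0, V0, β, A, r0, hβ, hA, hr0, bU, bV, hU2, hV2, hd, hbox⟩ := initial_series S hS hS0 u0 v0 hu0 hv0 hdiv0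
  obtain ⟨a, ha, ρ, f, hf, u, v, N, x, y, P, Q, W, eu, ev, eN, ex, ey, eP, eQ, eW, iu, iv, s1, s2, s3, s4, s5,
    s6, s7, s8, s9⟩ := system U0 V0 β A hβ hA bU bV hU2 hV2 hd
  have hasum : 0 < ∑ i, a i := Finset.sum_pos (fun i _ => ha i) Finset.univ_nonempty
  have hr1 : 0 < 1 / ∑ i, a i := by positivity
  have cf : ∀ i, Cv (1 / ∑ i, a i) (f i) := fun i => Bd.cv ha (hf i)
  have cx : Cv (1 / ∑ i, a i) x := ex ▸ cf 5
  have cy : Cv (1 / ∑ i, a i) y := ey ▸ cf 6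
  have cJ : Cv (1 / ∑ i, a i) (dd 0 x * dd 1 y - dd 1 x * dd 0 y) := by
    rw [sub_eq_add_neg]
    exact ((cx.dd 0).mul (cy.dd 1)).add ((cx.dd 1).mul (cy.dd 0)).neg
  have hJn : {q | 0 < Ev (dd 0 x * dd 1 y - dd 1 x * dd 0 y) q} ∈ nhds (0 : Fin 3 → ℝ) := by
    have hc := (analytic_Ev hr1 cJ 0 (fun i => by simpa using hr1)).continuousAt
    apply hc.eventually (lt_mem_nhds _)
    rw [Ev_origin, s9]; norm_num
  obtain ⟨r, hr, hrr, hJpos⟩ := bx_nhds hJn (lt_min hr0 hr1)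
  have hrr0 := hrr.trans (min_le_left _ _)
  have hrr1 := hrr.trans (min_le_right _ _)
  have cg : ∀ i, Cv r (f i) := fun i => (cf i).mono hrr1
  -- elements of the ring of convergent series
  obtain ⟨u, rfl⟩ : ∃ u' : AA r, u'.1 = u := ⟨⟨u, eu ▸ cg 0⟩, rfl⟩
  obtain ⟨v, rfl⟩ : ∃ u' : AA r, u'.1 = v := ⟨⟨v, ev ▸ cg 1⟩, rfl⟩
  obtain ⟨N, rfl⟩ : ∃ u' : AA r, u'.1 = N := ⟨⟨N, eN ▸ cg 2⟩, rfl⟩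
  obtain ⟨x, rfl⟩ : ∃ u' : AA r, u'.1 = x := ⟨⟨x, ex ▸ cg 5⟩, rfl⟩
  obtain ⟨y, rfl⟩ : ∃ u' : AA r, u'.1 = y := ⟨⟨y, ey ▸ cg 6⟩, rfl⟩
  obtain ⟨P, rfl⟩ : ∃ u' : AA r, u'.1 = P := ⟨⟨P, eP ▸ cg 7⟩, rfl⟩
  obtain ⟨Q, rfl⟩ : ∃ u' : AA r, u'.1 = Q := ⟨⟨Q, eQ ▸ cg 8⟩, rfl⟩
  obtain ⟨W, rfl⟩ : ∃ u' : AA r, u'.1 = W := ⟨⟨W, eW ▸ cg 9⟩, rfl⟩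
  replace s1 : Dr r 2 u = -(Dr r 0 N + Dr r 1 (u * v)) := Subtype.ext s1
  replace s2 : Dr r 2 v = -(Dr r 0 (u * v) + Dr r 1 (v * v - u * u + N)) := Subtype.ext s2
  replace s3 : Dr r 0 u + Dr r 1 v = 0 := Subtype.ext s3
  replace s4 : N * Dr r 0 x + (u * v) * Dr r 1 x = W * Dr r 1 Q := Subtype.ext s4
  replace s5 : N * Dr r 0 y + (u * v) * Dr r 1 y = -(W * Dr r 1 P) := Subtype.ext s5
  replace s6 : Dr r 0 P = (1 + P * P + Q * Q) * ((v * v - u * u + N) * Dr r 1 y + u * v * Dr r 0 y) :=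
    Subtype.ext s6
  replace s7 : Dr r 0 Q = (1 + P * P + Q * Q) * (-(v * v - u * u + N) * Dr r 1 x - u * v * Dr r 0 x) :=
    Subtype.ext s7
  replace s8 : W * (1 + P * P + Q * Q) = 1 := Subtype.ext s8
  clear cf cg cx cy cJ hJn eu ev eN ex ey eP eQ eW hf
  obtain ⟨X, hX⟩ : ∃ X : AA r, X = x + x := ⟨_, rfl⟩
  obtain ⟨Y, hY⟩ : ∃ Y : AA r, Y = y + y := ⟨_, rfl⟩
  obtain ⟨L, hL⟩ : ∃ L : AA r, L = v * v - u * u + N := ⟨_, rfl⟩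
  obtain ⟨M, hM⟩ : ∃ M : AA r, M = -(u * v) := ⟨_, rfl⟩
  obtain ⟨g11, e11⟩ : ∃ g : AA r, g = Dr r 0 X * Dr r 0 X + Dr r 0 Y * Dr r 0 Y
    + (P * Dr r 0 X + Q * Dr r 0 Y) * (P * Dr r 0 X + Q * Dr r 0 Y) := ⟨_, rfl⟩
  obtain ⟨g12, e12⟩ : ∃ g : AA r, g = Dr r 0 X * Dr r 1 X + Dr r 0 Y * Dr r 1 Y
    + (P * Dr r 0 X + Q * Dr r 0 Y) * (P * Dr r 1 X + Q * Dr r 1 Y) := ⟨_, rfl⟩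
  obtain ⟨g22, e22⟩ : ∃ g : AA r, g = Dr r 1 X * Dr r 1 X + Dr r 1 Y * Dr r 1 Y
    + (P * Dr r 1 X + Q * Dr r 1 Y) * (P * Dr r 1 X + Q * Dr r 1 Y) := ⟨_, rfl⟩
  obtain ⟨p, hp⟩ : ∃ p : AA r, p = N - u * u := ⟨_, rfl⟩
  obtain ⟨D, hD⟩ : ∃ D : Set (ℝ × ℝ × ℝ), D = {q : ℝ × ℝ × ℝ | (q.1, q.2.1) ∈
    {z : ℝ × ℝ | |z.1| < r ∧ |z.2| < r} ∧ q.2.2 ∈ Set.Ioo (-r) r} := ⟨_, rfl⟩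
  have hDb : ∀ q ∈ D, vv q ∈ bx r := by
    intro q hq i
    rw [hD] at hq
    obtain ⟨⟨h1, h2⟩, h3⟩ := hq
    fin_cases i
    · exact h1
    · exact h2
    · exact abs_lt.2 h3
  -- evaluation of the relevant functions
  have fu : ∀ q, vv q ∈ bx r → Ev u.1 (vv q) = Ev u.1 (vv q) := fun q hq => rfl
  have fv : ∀ q, vv q ∈ bx r → Ev v.1 (vv q) = Ev v.1 (vv q) := fun q hq => rfl
  have fN : ∀ q, vv q ∈ bx r → (Ev u.1 (vv q)) ^ 2 + Ev p.1 (vv q) = Ev N.1 (vv q) := by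
    intro q hq
    simp only [← Er_apply r _ hq, hp, map_sub, map_mul]; ring
  have fL : ∀ q, vv q ∈ bx r → (Ev v.1 (vv q)) ^ 2 + Ev p.1 (vv q) = Ev L.1 (vv q) := by
    intro q hq
    simp only [← Er_apply r _ hq, hp, hL, map_sub, map_mul, map_add]; ring
  have fM : ∀ q, vv q ∈ bx r → -(Ev u.1 (vv q) * Ev v.1 (vv q)) = Ev M.1 (vv q) := by
    intro q hq
    simp only [← Er_apply r _ hq, hM, map_neg, map_mul]
  have fuv : ∀ q, vv q ∈ bx r → Ev u.1 (vv q) * Ev v.1 (vv q) = Ev (u * v : AA r).1 (vv q) := by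
    intro q hq
    simp only [← Er_apply r _ hq, map_mul]
  have d11 : ∀ q, vv q ∈ bx r → (fun q => Ev g11.1 (vv q)) q = Ev g11.1 (vv q) := fun q hq => rfl
  have d12 : ∀ q, vv q ∈ bx r → (fun q => Ev g12.1 (vv q)) q = Ev g12.1 (vv q) := fun q hq => rfl
  have d22 : ∀ q, vv q ∈ bx r → (fun q => Ev g22.1 (vv q)) q = Ev g22.1 (vv q) := fun q hq => rfl
  have main := fun q (hq : vv q ∈ bx r) => formal_main (Dr r 0) (Dr r 1) (Dr_comm r 0 1) (Er r (vv q) hq)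
    (AA_can r) X Y P Q W L M N g11 g12 g22
    (by rw [hX, hM, map_add, map_add]; linear_combination 2 * s4)
    (by rw [hY, hM, map_add, map_add]; linear_combination 2 * s5)
    (by rw [hY, hM, hL, map_add, map_add]; linear_combination 2 * s6)
    (by rw [hX, hM, hL, map_add, map_add]; linear_combination 2 * s7) s8 e11 e12 e22
    (by
      have h0 : 0 < Er r (vv q) hq (Dr r 0 x * Dr r 1 y - Dr r 1 x * Dr r 0 y) := hJpos hq
      have h1 : Dr r 0 X * Dr r 1 Y - Dr r 1 X * Dr r 0 Y
          = (Dr r 0 x * Dr r 1 y - Dr r 1 x * Dr r 0 y) + (Dr r 0 x * Dr r 1 y - Dr r 1 x * Dr r 0 y)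
          + ((Dr r 0 x * Dr r 1 y - Dr r 1 x * Dr r 0 y) + (Dr r 0 x * Dr r 1 y - Dr r 1 x * Dr r 0 y)) := by
        rw [hX, hY]; simp only [map_add]; ring
      rw [h1, map_add, map_add]
      positivity) _ rfl
  have hGC : ∀ q ∈ D, GaussCodazzi (fun q => (Ev v.1 (vv q)) ^ 2 + Ev p.1 (vv q))
      (fun q => -(Ev u.1 (vv q) * Ev v.1 (vv q))) (fun q => (Ev u.1 (vv q)) ^ 2 + Ev p.1 (vv q))
      (fun q => Ev g11.1 (vv q)) (fun q => Ev g12.1 (vv q)) (fun q => Ev g22.1 (vv q)) q := by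
    intro q hq
    have hb := hDb q hq
    obtain ⟨-, m1, m2, m3⟩ := main q hb
    simp only [Er_apply] at m1 m2 m3
    unfold GaussCodazzi brioschi Gamma1_11 Gamma1_12 Gamma1_22 Gamma2_11 Gamma2_12 Gamma2_22 detg
    rw [pdx1_of fN q hb, pdx2_of fM q hb, pdx1_of fM q hb, pdx2_of fL q hb,
      pdx1_of d11 q hb, pdx1_of d12 q hb, pdx1_of d22 q hb, pdx2_of d11 q hb, pdx2_of d12 q hb, pdx2_of d22 q hb,
      pdx2_of (pdx2_of d11) q hb, pdx1_of (pdx2_of d12) q hb, pdx1_of (pdx1_of d22) q hb]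
    simp only [fN q hb, fM q hb, fL q hb]
    exact ⟨m1, m2, m3⟩
  refine ⟨r, {z : ℝ × ℝ | |z.1| < r ∧ |z.2| < r}, hr, ?_, ?_, ?_, fun q => Ev u.1 (vv q), fun q => Ev v.1 (vv q),
    fun q => Ev p.1 (vv q), fun q => Ev g11.1 (vv q), fun q => Ev g12.1 (vv q), fun q => Ev g22.1 (vv q), D, hD,
    an_of hr u hDb, an_of hr v hDb, an_of hr p hDb, an_of hr g11 hDb, an_of hr g12 hDb, an_of hr g22 hDb,
    ?_, ?_, ?_, ?_, ?_, hGC, ?_⟩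
  · exact (isOpen_lt (continuous_fst.abs) continuous_const).inter
      (isOpen_lt (continuous_snd.abs) continuous_const)
  · simpa using hr
  · intro z hz
    refine (hbox ![z.1, z.2, 0] fun i => ?_).1
    fin_cases i
    · exact hz.1.trans_le hrr0
    · exact hz.2.trans_le hrr0
    · simpa using hr0
  · intro q hq
    have hb := hDb q hq
    rw [pdx1_of fN q hb, pdx2_of fuv q hb, pdt_of fu q hb, s1]
    simp only [← Er_apply r _ hb, map_neg, map_add, neg_neg]
  · intro q hq
    have hb := hDb q hq
    rw [pdx1_of fuv q hb, pdx2_of fL q hb, pdt_of fv q hb, s2, hL]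
    simp only [← Er_apply r _ hb, map_neg, map_add, neg_neg]
  · intro q hq
    have hb := hDb q hq
    rw [pdx1_of fu q hb, pdx2_of fv q hb]
    have := congrArg (Er r _ hb) s3
    rw [map_add, map_zero] at this
    exact this
  · intro z hz
    have hb : ![z.1, z.2, 0] ∈ bx r0 := by
      intro i
      fin_cases i
      · exact hz.1.trans_le hrr0
      · exact hz.2.trans_le hrr0
      · simpa using hr0
    have hh := (hbox _ hb).2
    exact ⟨(Ev_slice _ _ iu _ rfl).trans hh.1, (Ev_slice _ _ iv _ rfl).trans hh.2⟩
  · intro q hq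
    exact (main q (hDb q hq)).1
  · intro q hq
    rw [← (hGC q hq).2.2]
    ring
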